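/- Let R be a commutative Noetherian local ring of Krull dimension d, C a semidualizing R-module, and M a nonzero finitely generated R-module belonging to the Auslander class A_C(R). Suppose that Hom_R(M,M) has finite C-injective dimension, that Ext_R^i(M,M) = 0 for all 1 ≤ i ≤ d−1, and that Ext_R^j(M,R) = 0 for all 1 ≤ j ≤ d. Then R is Cohen-Macaulay, M is free, and C is a canonical module for R (i.e., C has finite injective dimension). -/

import Mathlib

open CategoryTheory

noncomputable section

/-- The `i`-th Ext module of two `R`-modules. -/
def extMod (R : Type) [CommRing R] (i : ℕ) (M N : Type) [AddCommGroup M] [Module R M]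
    [AddCommGroup N] [Module R N] : ModuleCat R :=
  ((Ext R (ModuleCat R) i).obj (Opposite.op (ModuleCat.of R M))).obj (ModuleCat.of R N)

/-- The `i`-th Tor module of two `R`-modules. -/
def torMod (R : Type) [CommRing R] (i : ℕ) (M N : Type) [AddCommGroup M] [Module R M]
    [AddCommGroup N] [Module R N] : ModuleCat R :=
  ((Tor (ModuleCat R) i).obj (ModuleCat.of R M)).obj (ModuleCat.of R N)

/-- The depth of a module over a local ring: the infimum of the set of
indices `i` with `Ext^i(R/𝔪, N) ≠ 0`. -/
def moduleDepth (R : Type) [CommRing R] [IsLocalRing R] (N : Type) [AddCommGroup N]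
    [Module R N] : ℕ :=
  sInf {i : ℕ | ¬ Subsingleton (extMod R i (R ⧸ IsLocalRing.maximalIdeal R) N)}

/-- An `R`-module `N` has finite injective dimension iff there is an `n` such that
`Ext^i(M, N) = 0` for all modules `M` and all `i > n`. -/
def HasFiniteInjDim (R : Type) [CommRing R] (N : Type) [AddCommGroup N] [Module R N] : Prop :=
  ∃ n : ℕ, ∀ (M : Type) [AddCommGroup M] [Module R M], ∀ i : ℕ, n < i →
    Subsingleton (extMod R i M N)

/-- An `R`-module `M` has finite projective dimension iff there is an `n` such that
`Ext^i(M, N) = 0` for all modules `N` and all `i > n`. -/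
def HasFiniteProjDim (R : Type) [CommRing R] (M : Type) [AddCommGroup M] [Module R M] : Prop :=
  ∃ n : ℕ, ∀ (N : Type) [AddCommGroup N] [Module R N], ∀ i : ℕ, n < i →
    Subsingleton (extMod R i M N)

/-- The `𝔪`-torsion submodule `Γ_𝔪(M)` of a module over a local ring. -/
def mTorsion (R : Type) [CommRing R] [IsLocalRing R] (M : Type) [AddCommGroup M]
    [Module R M] : Submodule R M :=
  ⨆ n : ℕ, Submodule.torsionBySet R M ((IsLocalRing.maximalIdeal R ^ n : Ideal R) : Set R)

/-- A semidualizing module: the natural map `R → Hom(C,C)` is bijective and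
`Ext^i(C,C) = 0` for all `i ≥ 1`. -/
structure IsSemidualizing (R : Type) [CommRing R] (C : Type) [AddCommGroup C]
    [Module R C] : Prop where
  bijective : Function.Bijective (LinearMap.lsmul R C)
  ext_vanish : ∀ i : ℕ, 1 ≤ i → Subsingleton (extMod R i C C)

/-- Membership in the Auslander class `A_C(R)`: the natural map `M → Hom(C, C ⊗ M)` is
bijective, `Tor_i(C, M) = 0` and `Ext^i(C, C ⊗ M) = 0` for all `i ≥ 1`. -/
structure MemAuslanderClass (R : Type) [CommRing R] (C : Type) [AddCommGroup C] [Module R C]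
    (M : Type) [AddCommGroup M] [Module R M] : Prop where
  bijective : Function.Bijective ((TensorProduct.mk R C M).flip)
  tor_vanish : ∀ i : ℕ, 1 ≤ i → Subsingleton (torMod R i C M)
  ext_vanish : ∀ i : ℕ, 1 ≤ i → Subsingleton (extMod R i C (TensorProduct R C M))

/-- A module `N` is Tor-rigid if for every finitely generated module `M` and every `i ≥ 1`,
`Tor_i(M, N) = 0` implies `Tor_{i+1}(M, N) = 0`. -/
def IsTorRigid (R : Type) [CommRing R] (N : Type) [AddCommGroup N] [Module R N] : Prop :=
  ∀ (M : Type) [AddCommGroup M] [Module R M], Module.Finite R M →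
    ∀ i : ℕ, 1 ≤ i → Subsingleton (torMod R i M N) → Subsingleton (torMod R (i + 1) M N)

/-- The natural map `C ⊗ Hom(M,N) → Hom(M, C ⊗ N)`, sending `c ⊗ φ` to `m ↦ c ⊗ φ m`. -/
def homTensorMap (R : Type) [CommRing R] (C M N : Type) [AddCommGroup C] [Module R C]
    [AddCommGroup M] [Module R M] [AddCommGroup N] [Module R N] :
    TensorProduct R C (M →ₗ[R] N) →ₗ[R] (M →ₗ[R] TensorProduct R C N) :=
  TensorProduct.lift
    ((LinearMap.llcomp R M N (TensorProduct R C N)).comp (TensorProduct.mk R C N))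

section Bridge

variable {R : Type} [CommRing R]

theorem subsingleton_ext_succ_iff_of_resolution {X : ModuleCat.{0} R} (P : ProjectiveResolution X)
    (Y : ModuleCat.{0} R) (n : ℕ) :
    Subsingleton (((Ext R (ModuleCat.{0} R) (n + 1)).obj (Opposite.op X)).obj Y) ↔
      ∀ f : P.complex.X (n + 1) ⟶ Y, P.complex.d (n + 2) (n + 1) ≫ f = 0 →
        ∃ g : P.complex.X n ⟶ Y, P.complex.d (n + 1) n ≫ g = f := by
  rw [← ModuleCat.isZero_iff_subsingleton, (P.isoExt (n + 1) Y).isZero_iff,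
    ← HomologicalComplex.exactAt_iff_isZero_homology,
    HomologicalComplex.exactAt_iff' _ n (n + 1) (n + 2) (by simp) (by simp),
    ShortComplex.moduleCat_exact_iff]
  rfl

theorem subsingleton_ext_zero_iff_of_resolution {X : ModuleCat.{0} R} (P : ProjectiveResolution X)
    (Y : ModuleCat.{0} R) :
    Subsingleton (((Ext R (ModuleCat.{0} R) 0).obj (Opposite.op X)).obj Y) ↔
      ∀ f : P.complex.X 0 ⟶ Y, P.complex.d 1 0 ≫ f = 0 → f = 0 := by
  rw [← ModuleCat.isZero_iff_subsingleton, (P.isoExt 0 Y).isZero_iff,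
    ← HomologicalComplex.exactAt_iff_isZero_homology,
    HomologicalComplex.exactAt_iff' _ 0 0 1 (by simp) (by simp),
    ShortComplex.moduleCat_exact_iff]
  have key : ((P.complex.linearYonedaObj R Y).sc' 0 0 1).f = 0 :=
    (P.complex.linearYonedaObj R Y).shape _ _ (by simp)
  constructor
  · intro h f hf
    obtain ⟨g, hg⟩ := h f hf
    rw [key] at hg
    exact hg.symm
  · intro h f hf
    exact ⟨0, by rw [map_zero]; exact (h f hf).symm⟩

theorem subsingleton_ext_iff_subsingleton_abelianExt (X Y : ModuleCat.{0} R) (n : ℕ) :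
    Subsingleton (((Ext R (ModuleCat.{0} R) n).obj (Opposite.op X)).obj Y) ↔
      Subsingleton (Abelian.Ext.{0} X Y n) := by
  let P : ProjectiveResolution X := projectiveResolution X
  cases n with
  | zero =>
    rw [subsingleton_ext_zero_iff_of_resolution P, Abelian.Ext.homEquiv₀.subsingleton_congr]
    have hepi : Epi (P.π.f 0) := inferInstance
    change _ ↔ Subsingleton (((ChainComplex.single₀ (ModuleCat.{0} R)).obj X).X 0 ⟶ Y)
    constructor
    · intro h
      refine subsingleton_of_forall_eq 0 fun f => ?_
      have h0 := h (P.π.f 0 ≫ f) (by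
        rw [← Category.assoc, P.complex_d_comp_π_f_zero, Limits.zero_comp])
      exact (cancel_epi (P.π.f 0)).1 (h0.trans Limits.comp_zero.symm)
    · intro h f hf
      have hl : P.π.f 0 ≫ P.exact₀.desc f hf = f := P.exact₀.g_desc f hf
      have h0 : P.exact₀.desc f hf = 0 := h.elim _ _
      rw [h0] at hl
      exact hl.symm.trans Limits.comp_zero
  | succ n =>
    rw [subsingleton_ext_succ_iff_of_resolution P]
    constructor
    · intro h
      refine subsingleton_of_forall_eq 0 fun α => ?_
      obtain ⟨f, hf, rfl⟩ := P.extMk_surjective α (n + 2) rfl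
      exact (P.extMk_eq_zero_iff f _ _ hf n rfl).2 (h f hf)
    · intro h f hf
      exact (P.extMk_eq_zero_iff f (n + 2) rfl hf n rfl).1 (Subsingleton.elim _ _)

/-- The `n`-th Ext group of two `R`-modules, in the derived-category model. -/
abbrev AExt (R : Type) [CommRing R] (M N : Type) [AddCommGroup M] [Module R M]
    [AddCommGroup N] [Module R N] (n : ℕ) : Type :=
  Abelian.Ext.{0} (ModuleCat.of R M) (ModuleCat.of R N) n

theorem subsingleton_extMod_iff (i : ℕ) (M N : Type) [AddCommGroup M] [Module R M]
    [AddCommGroup N] [Module R N] :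
    Subsingleton (extMod R i M N) ↔ Subsingleton (AExt R M N i) :=
  subsingleton_ext_iff_subsingleton_abelianExt _ _ _

end Bridge

section ExtMaps

variable {R : Type} [CommRing R]
variable {M M' M'' N N' N'' : Type} [AddCommGroup M] [Module R M] [AddCommGroup M'] [Module R M']
  [AddCommGroup M''] [Module R M''] [AddCommGroup N] [Module R N] [AddCommGroup N'] [Module R N']
  [AddCommGroup N''] [Module R N'']

/-- Degree zero class of a linear map. -/
def homExt (f : M →ₗ[R] N) : AExt R M N 0 := Abelian.Ext.mk₀ (ModuleCat.ofHom f)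

/-- Pullback of extension classes along a linear map in the first variable. -/
def extPre (N : Type) [AddCommGroup N] [Module R N] (n : ℕ) (f : M' →ₗ[R] M) :
    AExt R M N n →ₗ[R] AExt R M' N n where
  toFun x := (homExt f).comp x (zero_add n)
  map_add' := by simp
  map_smul' := by simp

/-- Pushforward of extension classes along a linear map in the second variable. -/
def extPost (M : Type) [AddCommGroup M] [Module R M] (n : ℕ) (g : N →ₗ[R] N') :
    AExt R M N n →ₗ[R] AExt R M N' n where
  toFun x := x.comp (homExt g) (add_zero n)
  map_add' := by simp
  map_smul' := by simp

theorem homExt_bijective : Function.Bijective (homExt : (M →ₗ[R] N) → AExt R M N 0) := by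
  constructor
  · intro f g h
    have := (Abelian.Ext.mk₀_bijective _ _).1 h
    exact congrArg ModuleCat.Hom.hom this
  · intro x
    obtain ⟨f, rfl⟩ := (Abelian.Ext.mk₀_bijective _ _).2 x
    exact ⟨f.hom, rfl⟩

theorem subsingleton_aExt_zero_iff : Subsingleton (AExt R M N 0) ↔ Subsingleton (M →ₗ[R] N) :=
  (Equiv.ofBijective _ homExt_bijective).subsingleton_congr.symm

theorem homExt_comp (g : N →ₗ[R] N') (f : M →ₗ[R] N) :
    (homExt f).comp (homExt g) (add_zero 0) = homExt (g ∘ₗ f) := by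
  simp [homExt]

theorem homExt_add (f g : M →ₗ[R] N) : homExt (f + g) = homExt f + homExt g := by
  simp [homExt, ← Abelian.Ext.mk₀_add, ← ModuleCat.ofHom_add]

theorem homExt_smul (r : R) (f : M →ₗ[R] N) : homExt (r • f) = r • homExt f := by
  rw [homExt, homExt, ← Abelian.Ext.mk₀_smul]; rfl

theorem homExt_zero : homExt (0 : M →ₗ[R] N) = 0 := by
  have := homExt_smul (0 : R) (0 : M →ₗ[R] N); simpa using this

theorem extPre_homExt (f : M' →ₗ[R] M) (g : M →ₗ[R] N) :
    extPre N 0 f (homExt g) = homExt (g ∘ₗ f) := homExt_comp g f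

theorem extPost_homExt (f : M →ₗ[R] N) (g : N →ₗ[R] N') :
    extPost M 0 g (homExt f) = homExt (g ∘ₗ f) := homExt_comp g f

theorem extPre_comp (n : ℕ) (f : M' →ₗ[R] M) (f' : M'' →ₗ[R] M') (x : AExt R M N n) :
    extPre N n f' (extPre N n f x) = extPre N n (f ∘ₗ f') x := by
  change (homExt f').comp ((homExt f).comp x (zero_add n)) (zero_add n) =
    (homExt (f ∘ₗ f')).comp x (zero_add n)
  rw [← homExt_comp, Abelian.Ext.comp_assoc_of_second_deg_zero]

theorem extPost_comp (n : ℕ) (g : N →ₗ[R] N') (g' : N' →ₗ[R] N'') (x : AExt R M N n) :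
    extPost M n g' (extPost M n g x) = extPost M n (g' ∘ₗ g) x := by
  change (x.comp (homExt g) (add_zero n)).comp (homExt g') (add_zero n) =
    x.comp (homExt (g' ∘ₗ g)) (add_zero n)
  rw [← homExt_comp, Abelian.Ext.comp_assoc_of_third_deg_zero]

theorem extPre_extPost (n : ℕ) (f : M' →ₗ[R] M) (g : N →ₗ[R] N') (x : AExt R M N n) :
    extPre N' n f (extPost M n g x) = extPost M' n g (extPre N n f x) := by
  change (homExt f).comp (x.comp (homExt g) (add_zero n)) (zero_add n) =
    ((homExt f).comp x (zero_add n)).comp (homExt g) (add_zero n)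
  rw [Abelian.Ext.comp_assoc_of_third_deg_zero]

@[simp]
theorem extPre_id (n : ℕ) (x : AExt R M N n) : extPre N n LinearMap.id x = x :=
  Abelian.Ext.mk₀_id_comp x

@[simp]
theorem extPost_id (n : ℕ) (x : AExt R M N n) : extPost M n LinearMap.id x = x :=
  Abelian.Ext.comp_mk₀_id x

theorem extPre_add (n : ℕ) (f g : M' →ₗ[R] M) (x : AExt R M N n) :
    extPre N n (f + g) x = extPre N n f x + extPre N n g x := by
  simp [extPre, homExt_add]

theorem extPost_add (n : ℕ) (f g : N →ₗ[R] N') (x : AExt R M N n) :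
    extPost M n (f + g) x = extPost M n f x + extPost M n g x := by
  simp [extPost, homExt_add]

theorem extPre_smul (n : ℕ) (r : R) (f : M' →ₗ[R] M) (x : AExt R M N n) :
    extPre N n (r • f) x = r • extPre N n f x := by
  simp [extPre, homExt_smul]

theorem extPost_smul (n : ℕ) (r : R) (f : N →ₗ[R] N') (x : AExt R M N n) :
    extPost M n (r • f) x = r • extPost M n f x := by
  simp [extPost, homExt_smul]

@[simp]
theorem extPre_zero (n : ℕ) (x : AExt R M N n) : extPre N n (0 : M' →ₗ[R] M) x = 0 := by
  simp [extPre, homExt_zero]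

@[simp]
theorem extPost_zero (n : ℕ) (x : AExt R M N n) : extPost M n (0 : N →ₗ[R] N') x = 0 := by
  simp [extPost, homExt_zero]

theorem extPre_sum (n : ℕ) {ι : Type*} (s : Finset ι) (f : ι → M' →ₗ[R] M) (x : AExt R M N n) :
    extPre N n (∑ i ∈ s, f i) x = ∑ i ∈ s, extPre N n (f i) x := by
  classical
  induction s using Finset.induction_on with
  | empty => simp
  | insert a s ha ih => rw [Finset.sum_insert ha, Finset.sum_insert ha, extPre_add, ih]

theorem extPost_sum (n : ℕ) {ι : Type*} (s : Finset ι) (f : ι → N →ₗ[R] N') (x : AExt R M N n) :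
    extPost M n (∑ i ∈ s, f i) x = ∑ i ∈ s, extPost M n (f i) x := by
  classical
  induction s using Finset.induction_on with
  | empty => simp
  | insert a s ha ih => rw [Finset.sum_insert ha, Finset.sum_insert ha, extPost_add, ih]

theorem subsingleton_aExt_of_retract_left {n : ℕ} (s : M' →ₗ[R] M) (p : M →ₗ[R] M')
    (h : p ∘ₗ s = LinearMap.id) (hx : Subsingleton (AExt R M N n)) :
    Subsingleton (AExt R M' N n) := by
  refine subsingleton_of_forall_eq 0 fun x => ?_
  rw [← extPre_id n x, ← h, ← extPre_comp, Subsingleton.elim (extPre N n p x) 0, map_zero]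

theorem subsingleton_aExt_of_retract_right {n : ℕ} (s : N' →ₗ[R] N) (p : N →ₗ[R] N')
    (h : p ∘ₗ s = LinearMap.id) (hx : Subsingleton (AExt R M N n)) :
    Subsingleton (AExt R M N' n) := by
  refine subsingleton_of_forall_eq 0 fun x => ?_
  rw [← extPost_id n x, ← h, ← extPost_comp, Subsingleton.elim (extPost M n s x) 0, map_zero]

theorem subsingleton_aExt_of_projective [Module.Projective R M] {n : ℕ} (hn : 1 ≤ n) :
    Subsingleton (AExt R M N n) := by
  obtain ⟨n, rfl⟩ := Nat.exists_eq_add_of_le' hn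
  have : Projective (ModuleCat.of R M) := (IsProjective.iff_projective M).1 inferInstance
  exact Abelian.Ext.subsingleton_of_projective _ _ n

instance [IsNoetherianRing R] [Module.Finite R M] [Module.Finite R N] (n : ℕ) :
    Module.Finite R (AExt R M N n) :=
  inferInstance

end ExtMaps

section Exact

variable {R : Type} [CommRing R]

/-- A short exact sequence of linear maps. -/
structure IsSES {A B C : Type} [AddCommGroup A] [Module R A] [AddCommGroup B] [Module R B]
    [AddCommGroup C] [Module R C] (f : A →ₗ[R] B) (g : B →ₗ[R] C) : Prop where
  inj : Function.Injective f
  exact : Function.Exact f g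
  surj : Function.Surjective g

namespace IsSES

variable {A B C : Type} [AddCommGroup A] [Module R A] [AddCommGroup B] [Module R B]
    [AddCommGroup C] [Module R C] {f : A →ₗ[R] B} {g : B →ₗ[R] C}
variable (h : IsSES f g) (X : Type) [AddCommGroup X] [Module R X]

include h

theorem shortExact :
    (ModuleCat.shortComplexOfCompEqZero f g h.exact.linearMap_comp_eq_zero).ShortExact where
  exact := (ShortComplex.ShortExact.moduleCat_exact_iff_function_exact _).2 h.exact
  mono_f := (ModuleCat.mono_iff_injective _).2 h.inj
  epi_g := (ModuleCat.epi_iff_surjective _).2 h.surj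

/-- The extension class of a short exact sequence. -/
def extClass : AExt R C A 1 := h.shortExact.extClass

theorem post_exact {n : ℕ} (x : AExt R X B n) (hx : extPost X n g x = 0) :
    ∃ y, extPost X n f y = x :=
  Abelian.Ext.covariant_sequence_exact₂ (ModuleCat.of R X) h.shortExact x hx

theorem pre_exact {n : ℕ} (x : AExt R B X n) (hx : extPre X n f x = 0) :
    ∃ y, extPre X n g y = x :=
  Abelian.Ext.contravariant_sequence_exact₂ h.shortExact (ModuleCat.of R X) x hx

theorem post_surjective {n : ℕ} (hA : Subsingleton (AExt R X A (n + 1))) :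
    Function.Surjective (extPost X n g) := fun x =>
  Abelian.Ext.covariant_sequence_exact₃ (ModuleCat.of R X) h.shortExact x rfl
    (Subsingleton.elim (α := AExt R X A (n + 1)) _ _)

theorem pre_surjective {n : ℕ} (hC : Subsingleton (AExt R C X (n + 1))) :
    Function.Surjective (extPre X n f) := fun x =>
  Abelian.Ext.contravariant_sequence_exact₁ h.shortExact (ModuleCat.of R X) x (add_comm 1 n)
    (Subsingleton.elim (α := AExt R C X (n + 1)) _ _)

theorem post_injective {n : ℕ} (hC : Subsingleton (AExt R X C n)) :
    Function.Injective (extPost X (n + 1) f) := by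
  refine (injective_iff_map_eq_zero _).2 fun x hx => ?_
  obtain ⟨y, rfl⟩ := Abelian.Ext.covariant_sequence_exact₁ (ModuleCat.of R X) h.shortExact x hx rfl
  rw [Subsingleton.elim (α := AExt R X C n) y 0]
  simp

theorem pre_injective {n : ℕ} (hA : Subsingleton (AExt R A X n)) :
    Function.Injective (extPre X (n + 1) g) := by
  refine (injective_iff_map_eq_zero _).2 fun x hx => ?_
  obtain ⟨y, rfl⟩ := Abelian.Ext.contravariant_sequence_exact₃ h.shortExact
    (ModuleCat.of R X) x hx (add_comm 1 n)
  rw [Subsingleton.elim (α := AExt R A X n) y 0]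
  simp

theorem subsingleton_pre_mid {n : ℕ} (hA : Subsingleton (AExt R A X n))
    (hC : Subsingleton (AExt R C X n)) : Subsingleton (AExt R B X n) := by
  refine subsingleton_of_forall_eq 0 fun x => ?_
  obtain ⟨y, rfl⟩ := h.pre_exact X x (Subsingleton.elim _ _)
  rw [Subsingleton.elim y 0, map_zero]

theorem subsingleton_post_right {n : ℕ} (hB : Subsingleton (AExt R X B n))
    (hA : Subsingleton (AExt R X A (n + 1))) : Subsingleton (AExt R X C n) :=
  (h.post_surjective X hA).subsingleton

theorem subsingleton_pre_left {n : ℕ} (hB : Subsingleton (AExt R B X n))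
    (hC : Subsingleton (AExt R C X (n + 1))) : Subsingleton (AExt R A X n) :=
  (h.pre_surjective X hC).subsingleton

theorem subsingleton_pre_right {n : ℕ} (hA : Subsingleton (AExt R A X n))
    (hB : Subsingleton (AExt R B X (n + 1))) : Subsingleton (AExt R C X (n + 1)) :=
  (h.pre_injective X hA).subsingleton

theorem exists_lift (hA : Subsingleton (AExt R X A 1)) (u : X →ₗ[R] C) :
    ∃ v : X →ₗ[R] B, g ∘ₗ v = u := by
  obtain ⟨y, hy⟩ := h.post_surjective X (n := 0) hA (homExt u)
  obtain ⟨v, rfl⟩ := homExt_bijective.2 y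
  exact ⟨v, homExt_bijective.1 (by rw [← hy, extPost_homExt])⟩

end IsSES

end Exact

section Quo

variable {R : Type} [CommRing R]

/-- The quotient `G / I G`. -/
abbrev Quo (I : Ideal R) (G : Type) [AddCommGroup G] [Module R G] : Type :=
  G ⧸ (I • ⊤ : Submodule R G)

variable {G G' : Type} [AddCommGroup G] [Module R G] [AddCommGroup G'] [Module R G']

/-- The projection `G → G / I G`. -/
def quoMk (I : Ideal R) (G : Type) [AddCommGroup G] [Module R G] : G →ₗ[R] Quo I G :=
  Submodule.mkQ _

theorem quoMk_surjective (I : Ideal R) : Function.Surjective (quoMk I G) :=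
  Submodule.mkQ_surjective _

theorem quoMk_eq_zero_iff {I : Ideal R} {g : G} : quoMk I G g = 0 ↔ g ∈ (I • ⊤ : Submodule R G) :=
  Submodule.Quotient.mk_eq_zero _

theorem smul_top_le_comap (I : Ideal R) (f : G →ₗ[R] G') :
    (I • ⊤ : Submodule R G) ≤ (I • ⊤ : Submodule R G').comap f :=
  Submodule.smul_le.2 fun r hr g _ => by
    rw [Submodule.mem_comap, map_smul]; exact Submodule.smul_mem_smul hr trivial

/-- The map `G / I G → G' / I G'` induced by a linear map `G → G'`. -/
def quoMap (I : Ideal R) (f : G →ₗ[R] G') : Quo I G →ₗ[R] Quo I G' :=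
  Submodule.mapQ _ _ f (smul_top_le_comap I f)

@[simp]
theorem quoMap_quoMk (I : Ideal R) (f : G →ₗ[R] G') (g : G) :
    quoMap I f (quoMk I G g) = quoMk I G' (f g) := rfl

/-- The projection `G / I G → G / J G` for `I ≤ J`. -/
def quoFactor {I J : Ideal R} (h : I ≤ J) (G : Type) [AddCommGroup G] [Module R G] :
    Quo I G →ₗ[R] Quo J G :=
  Submodule.factor (Submodule.smul_mono_left h)

@[simp]
theorem quoFactor_quoMk {I J : Ideal R} (h : I ≤ J) (g : G) :
    quoFactor h G (quoMk I G g) = quoMk J G g := rfl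

theorem quoFactor_surjective {I J : Ideal R} (h : I ≤ J) :
    Function.Surjective (quoFactor h G) := fun x => by
  obtain ⟨g, rfl⟩ := quoMk_surjective J x
  exact ⟨quoMk I G g, rfl⟩

theorem quo_hom_ext {I : Ideal R} {f f' : Quo I G →ₗ[R] G'}
    (h : f ∘ₗ quoMk I G = f' ∘ₗ quoMk I G) : f = f' :=
  Submodule.linearMap_qext _ h

/-- `G / 0 G` is `G`. -/
def quoBot (G : Type) [AddCommGroup G] [Module R G] : Quo (⊥ : Ideal R) G ≃ₗ[R] G :=
  Submodule.quotEquivOfEqBot _ (by simp)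

@[simp]
theorem quoBot_quoMk (g : G) : quoBot G (quoMk (⊥ : Ideal R) G g) = g := rfl

theorem smul_mem_smul_top {I : Ideal R} {r : R} (hr : r ∈ I) (g : G) :
    r • g ∈ (I • ⊤ : Submodule R G) := Submodule.smul_mem_smul hr trivial

theorem smul_quo_eq_zero {I : Ideal R} {r : R} (hr : r ∈ I) (x : Quo I G) : r • x = 0 := by
  obtain ⟨g, rfl⟩ := quoMk_surjective I x
  rw [← map_smul, quoMk_eq_zero_iff]
  exact smul_mem_smul_top hr g

theorem mem_sup_span_smul_top {I : Ideal R} {y : R} {g : G} :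
    g ∈ ((I ⊔ Ideal.span {y}) • ⊤ : Submodule R G) ↔
      ∃ b, g - y • b ∈ (I • ⊤ : Submodule R G) := by
  rw [Submodule.sup_smul, Submodule.mem_sup]
  constructor
  · rintro ⟨a, ha, c, hc, rfl⟩
    rw [Submodule.ideal_span_singleton_smul] at hc
    obtain ⟨b, -, rfl⟩ := hc
    exact ⟨b, by simpa using ha⟩
  · rintro ⟨b, hb⟩
    exact ⟨_, hb, y • b, smul_mem_smul_top (Ideal.mem_span_singleton_self y) b, by simp⟩

theorem quoMk_sup_eq_zero_iff {I : Ideal R} {y : R} {g : G} :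
    quoMk (I ⊔ Ideal.span {y}) G g = 0 ↔ ∃ b, quoMk I G g = y • quoMk I G b := by
  rw [quoMk_eq_zero_iff, mem_sup_span_smul_top]
  refine exists_congr fun b => ?_
  rw [← quoMk_eq_zero_iff, map_sub, map_smul, sub_eq_zero]

theorem exact_smul_quoFactor (I : Ideal R) (y : R) :
    Function.Exact (y • LinearMap.id : Quo I G →ₗ[R] Quo I G)
      (quoFactor (le_sup_left : I ≤ I ⊔ Ideal.span {y}) G) := by
  intro x
  obtain ⟨g, rfl⟩ := quoMk_surjective I x
  rw [quoFactor_quoMk, quoMk_sup_eq_zero_iff]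
  constructor
  · rintro ⟨b, hb⟩
    exact ⟨quoMk I G b, hb.symm⟩
  · rintro ⟨b, hb⟩
    obtain ⟨b, rfl⟩ := quoMk_surjective I b
    exact ⟨b, hb.symm⟩

theorem isSES_quo {I : Ideal R} {y : R} (hy : IsSMulRegular (Quo I G) y) :
    IsSES (y • LinearMap.id : Quo I G →ₗ[R] Quo I G)
      (quoFactor (le_sup_left : I ≤ I ⊔ Ideal.span {y}) G) where
  inj := hy
  exact := exact_smul_quoFactor I y
  surj := quoFactor_surjective _

/-- `G / (I + (y)) G` is the quotient of `G / I G` by `y`. -/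
def quotSMulTopQuoEquiv (I : Ideal R) (y : R) :
    QuotSMulTop y (Quo I G) ≃ₗ[R] Quo (I ⊔ Ideal.span {y}) G :=
  (Submodule.quotEquivOfEq _ _ (by
    rw [(exact_smul_quoFactor (G := G) I y).linearMap_ker_eq]
    ext x
    simp [Submodule.mem_smul_pointwise_iff_exists])).trans
    (LinearMap.quotKerEquivOfSurjective _
      (quoFactor_surjective (G := G) (le_sup_left : I ≤ I ⊔ Ideal.span {y})))

end Quo

section Chain

variable {R : Type} [CommRing R] [IsLocalRing R]

open IsLocalRing

/-- `RegIdeal I n` means that `I` is generated by an `R`-regular sequence of length `n` in the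
maximal ideal. -/
inductive RegIdeal : Ideal R → ℕ → Prop
  | zero : RegIdeal ⊥ 0
  | succ {I : Ideal R} {n : ℕ} {y : R} (hI : RegIdeal I n) (hy : y ∈ maximalIdeal R)
      (hreg : IsSMulRegular (Quo I R) y) : RegIdeal (I ⊔ Ideal.span {y}) (n + 1)

theorem RegIdeal.le_maximalIdeal {I : Ideal R} {n : ℕ} (h : RegIdeal I n) :
    I ≤ maximalIdeal R := by
  induction h with
  | zero => exact bot_le
  | succ hI hy hreg ih => exact sup_le ih ((Ideal.span_singleton_le_iff_mem _).2 hy)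

theorem RegIdeal.nontrivial_quo {I : Ideal R} {n : ℕ} (h : RegIdeal I n) :
    Nontrivial (Quo I R) := by
  rw [Submodule.Quotient.nontrivial_iff]
  intro htop
  refine (maximalIdeal.isMaximal R).ne_top (top_le_iff.1 (le_trans (le_of_eq ?_) h.le_maximalIdeal))
  rw [← htop]
  simp

theorem RegIdeal.supportDim_add [IsNoetherianRing R] {I : Ideal R} {n : ℕ} (h : RegIdeal I n) :
    Module.supportDim R (Quo I R) + n = ringKrullDim R := by
  induction h with
  | zero =>
    rw [Module.supportDim_eq_of_equiv (quoBot R), Module.supportDim_self_eq_ringKrullDim]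
    simp
  | @succ I n y hI hy hreg ih =>
    have hmem : y ∈ (Module.annihilator R (Quo I R)).jacobson :=
      maximalIdeal_le_jacobson _ hy
    rw [← ih, ← Module.supportDim_quotSMulTop_succ_eq_supportDim_mem_jacobson hreg hmem,
      Module.supportDim_eq_of_equiv (quotSMulTopQuoEquiv I y)]
    push_cast
    rw [add_assoc, add_comm (1 : WithBot ℕ∞)]

theorem smul_eq_zero_of_mem_maximalIdeal {y : R} (hy : y ∈ maximalIdeal R) {N : Type}
    [AddCommGroup N] [Module R N] {n : ℕ} (x : AExt R (R ⧸ maximalIdeal R) N n) : y • x = 0 := by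
  rw [← extPre_id n (y • x), map_smul, ← extPre_smul]
  have : y • (LinearMap.id : (R ⧸ maximalIdeal R) →ₗ[R] _) = 0 := by
    ext
    exact Ideal.Quotient.eq_zero_iff_mem.2 (Ideal.mul_mem_right 1 _ hy)
  rw [this, extPre_zero]

variable {T : ℕ} (hT : ∀ i < T, Subsingleton (AExt R (R ⧸ maximalIdeal R) R i))

include hT in
theorem RegIdeal.subsingleton_ext {I : Ideal R} {n : ℕ} (h : RegIdeal I n) :
    ∀ i, i + n < T → Subsingleton (AExt R (R ⧸ maximalIdeal R) (Quo I R) i) := by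
  induction h with
  | zero =>
    intro i hi
    exact subsingleton_aExt_of_retract_right (quoBot R).toLinearMap (quoBot R).symm.toLinearMap
      (by ext; simp) (hT i hi)
  | succ hI hy hreg ih =>
    intro i hi
    exact (isSES_quo hreg).subsingleton_post_right _ (ih i (by omega)) (ih (i + 1) (by omega))

theorem RegIdeal.nontrivial_ext {I : Ideal R} {n t : ℕ} (h : RegIdeal I n)
    (ht : ¬ Subsingleton (AExt R (R ⧸ maximalIdeal R) R t)) :
    ∀ i, i + n = t → ¬ Subsingleton (AExt R (R ⧸ maximalIdeal R) (Quo I R) i) := by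
  induction h with
  | zero =>
    rintro i rfl hs
    exact ht (subsingleton_aExt_of_retract_right (quoBot R).symm.toLinearMap
      (quoBot R).toLinearMap (by ext; simp) hs)
  | @succ I n y hI hy hreg ih =>
    intro i hi hs
    refine ih (i + 1) (by omega) (subsingleton_of_forall_eq 0 fun x => ?_)
    refine (isSES_quo hreg).post_injective _ hs ?_
    rw [extPost_smul, extPost_id, map_zero, smul_eq_zero_of_mem_maximalIdeal hy]

variable [IsNoetherianRing R]

include hT in
theorem RegIdeal.exists_regular {I : Ideal R} {n : ℕ} (h : RegIdeal I n) (hn : n < T) :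
    ∃ y ∈ maximalIdeal R, IsSMulRegular (Quo I R) y := by
  have := subsingleton_aExt_zero_iff.1 (h.subsingleton_ext hT 0 (by omega))
  obtain ⟨y, hy, hreg⟩ := IsSMulRegular.subsingleton_linearMap_iff.1 this
  rw [Ideal.annihilator_quotient] at hy
  exact ⟨y, hy, hreg⟩

include hT in
theorem RegIdeal.exists_extension {I : Ideal R} {n : ℕ} (h : RegIdeal I n) (hn : n ≤ T) (a : ℕ) :
    ∃ J, RegIdeal J T ∧ I ≤ J ∧ J ≤ I ⊔ maximalIdeal R ^ a := by
  obtain ⟨m, rfl⟩ := Nat.exists_eq_add_of_le hn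
  induction m generalizing I n with
  | zero => exact ⟨I, h, le_rfl, le_sup_left⟩
  | succ m ih =>
    obtain ⟨y, hy, hreg⟩ := h.exists_regular hT (by omega)
    have hy' : y ^ (a + 1) ∈ maximalIdeal R := Ideal.pow_mem_of_mem _ hy _ (by omega)
    have hT' : ∀ i < n + 1 + m, Subsingleton (AExt R (R ⧸ maximalIdeal R) R i) :=
      fun i hi => hT i (by omega)
    obtain ⟨J, hJ, hle, hle'⟩ := ih (h.succ hy' (hreg.pow (a + 1))) hT' (by omega)
    refine ⟨J, by rwa [show n + (m + 1) = n + 1 + m by omega], le_sup_left.trans hle,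
      hle'.trans (sup_le (sup_le le_sup_left ?_) le_sup_right)⟩
    refine le_sup_of_le_right ((Ideal.span_singleton_le_iff_mem _).2 ?_)
    exact Ideal.pow_le_pow_right (Nat.le_succ a) (Ideal.pow_mem_pow hy (a + 1))

include hT in
theorem exists_regIdeal (a : ℕ) : ∃ J : Ideal R, RegIdeal J T ∧ J ≤ maximalIdeal R ^ a := by
  obtain ⟨J, hJ, -, h⟩ := RegIdeal.zero.exists_extension hT (Nat.zero_le T) a
  exact ⟨J, hJ, by simpa using h⟩

theorem RegIdeal.le_of_ringKrullDim_eq {d : ℕ} (hd : ringKrullDim R = d) {I : Ideal R} {n : ℕ}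
    (h : RegIdeal I n) : n ≤ d := by
  have h1 := h.supportDim_add
  have := h.nontrivial_quo
  have h2 := Module.supportDim_ne_bot_of_nontrivial R (Quo I R)
  rw [hd] at h1
  obtain ⟨e, he⟩ := WithBot.ne_bot_iff_exists.1 h2
  rw [← he] at h1
  have h3 : e + n = d := by exact_mod_cast h1
  have h4 : (n : ℕ∞) ≤ d := by rw [← h3]; exact le_add_self
  exact_mod_cast h4

theorem exists_depth {d : ℕ} (hd : ringKrullDim R = d) :
    ∃ t ≤ d, (∀ i < t, Subsingleton (AExt R (R ⧸ maximalIdeal R) R i)) ∧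
      ¬ Subsingleton (AExt R (R ⧸ maximalIdeal R) R t) := by
  classical
  have hex : ∃ t, ¬ Subsingleton (AExt R (R ⧸ maximalIdeal R) R t) := by
    by_contra! h
    obtain ⟨J, hJ, -⟩ := exists_regIdeal (T := d + 1) (fun i _ => h i) 0
    exact absurd (hJ.le_of_ringKrullDim_eq hd) (by omega)
  have hmin : ∀ i < Nat.find hex, Subsingleton (AExt R (R ⧸ maximalIdeal R) R i) :=
    fun i hi => not_not.1 (Nat.find_min hex hi)
  obtain ⟨J, hJ, -⟩ := exists_regIdeal hmin 0
  exact ⟨Nat.find hex, hJ.le_of_ringKrullDim_eq hd, hmin, Nat.find_spec hex⟩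

end Chain

section Bass

variable {R : Type} [CommRing R]

theorem mem_smul_top_self {I : Ideal R} {r : R} : r ∈ (I • ⊤ : Submodule R R) ↔ r ∈ I := by simp

/-- The quotient `R / I R` is the quotient ring `R / I`. -/
def quoSelf (I : Ideal R) : Quo I R ≃ₗ[R] R ⧸ I := Submodule.quotEquivOfEq _ _ (by simp)

theorem subsingleton_aExt_congr_left {M M' N : Type} [AddCommGroup M] [Module R M]
    [AddCommGroup M'] [Module R M'] [AddCommGroup N] [Module R N] (e : M ≃ₗ[R] M') {n : ℕ} :
    Subsingleton (AExt R M N n) ↔ Subsingleton (AExt R M' N n) :=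
  ⟨subsingleton_aExt_of_retract_left e.symm.toLinearMap e.toLinearMap (by ext; simp),
    subsingleton_aExt_of_retract_left e.toLinearMap e.symm.toLinearMap (by ext; simp)⟩

theorem subsingleton_aExt_of_subsingleton_left {M N : Type} [AddCommGroup M] [Module R M]
    [AddCommGroup N] [Module R N] [Subsingleton M] (n : ℕ) : Subsingleton (AExt R M N n) := by
  refine subsingleton_of_forall_eq 0 fun x => ?_
  rw [← extPre_id n x, Subsingleton.elim (LinearMap.id : M →ₗ[R] M) 0, extPre_zero]

theorem exists_isSES_quo_mul (I : Ideal R) (a : R) :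
    ∃ f : Quo (Submodule.comap (LinearMap.toSpanSingleton R R a) I) R →ₗ[R] Quo I R,
      IsSES f (quoFactor (le_sup_left : I ≤ I ⊔ Ideal.span {a}) R) ∧
      ∀ r, f (quoMk _ R r) = r • quoMk I R a := by
  set K : Ideal R := Submodule.comap (LinearMap.toSpanSingleton R R a) I
  have hK : (K • ⊤ : Submodule R R) ≤ (I • ⊤ : Submodule R R).comap
      (LinearMap.toSpanSingleton R R a) := by
    intro r hr
    rw [mem_smul_top_self] at hr
    rw [Submodule.mem_comap, mem_smul_top_self]
    exact hr
  refine ⟨Submodule.mapQ _ _ _ hK, ⟨?_, ?_, quoFactor_surjective _⟩,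
    fun r => map_smul (quoMk I R) r a⟩
  · refine (injective_iff_map_eq_zero _).2 fun x hx => ?_
    obtain ⟨r, rfl⟩ := quoMk_surjective K x
    have hr : r • a ∈ (I • ⊤ : Submodule R R) := quoMk_eq_zero_iff.1 hx
    rw [mem_smul_top_self] at hr
    exact quoMk_eq_zero_iff.2 (mem_smul_top_self.2 hr)
  · intro x
    rw [exact_smul_quoFactor I a x]
    constructor
    · rintro ⟨z, rfl⟩
      obtain ⟨b, rfl⟩ := quoMk_surjective I z
      refine ⟨quoMk K R b, ?_⟩
      change quoMk I R (b • a) = a • quoMk I R b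
      exact (congrArg (quoMk I R) (mul_comm b a)).trans (map_smul (quoMk I R) a b)
    · rintro ⟨z, rfl⟩
      obtain ⟨b, rfl⟩ := quoMk_surjective K z
      refine ⟨quoMk I R b, ?_⟩
      change a • quoMk I R b = quoMk I R (b • a)
      exact (map_smul (quoMk I R) a b).symm.trans (congrArg (quoMk I R) (mul_comm a b))

theorem isSMulRegular_quo_of_isPrime {I : Ideal R} (hI : I.IsPrime) {y : R} (hy : y ∉ I) :
    IsSMulRegular (Quo I R) y := by
  rw [isSMulRegular_iff_right_eq_zero_of_smul]
  intro x hx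
  obtain ⟨r, rfl⟩ := quoMk_surjective I x
  rw [← map_smul, quoMk_eq_zero_iff, mem_smul_top_self] at hx
  rw [quoMk_eq_zero_iff, mem_smul_top_self]
  exact (hI.mem_or_mem hx).resolve_left hy

variable [IsLocalRing R]

open IsLocalRing

theorem subsingleton_of_surjective_smul {E : Type*} [AddCommGroup E] [Module R E]
    [Module.Finite R E] {y : R} (hy : y ∈ maximalIdeal R)
    (h : Function.Surjective (y • · : E → E)) : Subsingleton E := by
  rw [← Submodule.subsingleton_iff R, ← subsingleton_iff_bot_eq_top, eq_comm]
  refine Submodule.eq_bot_of_le_smul_of_le_jacobson_bot (maximalIdeal R) ⊤ Module.Finite.fg_top ?_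
    (maximalIdeal_le_jacobson _)
  intro x _
  obtain ⟨z, rfl⟩ := h x
  exact Submodule.smul_mem_smul hy trivial

variable [IsNoetherianRing R] {X : Type} [AddCommGroup X] [Module R X] [Module.Finite R X] {r : ℕ}

theorem subsingleton_aExt_quo_of_isPrime
    (hr : ∀ (N : Type) [AddCommGroup N] [Module R N] [Module.Finite R N],
      Subsingleton (AExt R N X (r + 1)))
    {I : Ideal R} (hI : I.IsPrime) (hne : I ≠ maximalIdeal R) :
    Subsingleton (AExt R (Quo I R) X r) := by
  obtain ⟨y, hy, hyI⟩ := SetLike.exists_of_lt (lt_of_le_of_ne (le_maximalIdeal hI.ne_top) hne)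
  have hses := isSES_quo (isSMulRegular_quo_of_isPrime hI hyI)
  refine subsingleton_of_surjective_smul hy fun x => ?_
  obtain ⟨z, hz⟩ := hses.pre_surjective X (hr _) x
  exact ⟨z, by rw [← hz, extPre_smul, extPre_id]⟩

theorem subsingleton_aExt_quo
    (hr : ∀ (N : Type) [AddCommGroup N] [Module R N] [Module.Finite R N],
      Subsingleton (AExt R N X (r + 1)))
    (hk : Subsingleton (AExt R (R ⧸ maximalIdeal R) X r)) (I : Ideal R) :
    Subsingleton (AExt R (Quo I R) X r) := by
  induction I using IsNoetherian.induction with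
  | hgt I ih =>
  by_cases htop : I = ⊤
  · have : Subsingleton (Quo I R) := by
      rw [Submodule.Quotient.subsingleton_iff, htop]; simp
    exact subsingleton_aExt_of_subsingleton_left r
  by_cases hI : Ideal.IsPrime I
  · by_cases hm : I = maximalIdeal R
    · subst hm
      exact (subsingleton_aExt_congr_left (quoSelf _)).2 hk
    · exact subsingleton_aExt_quo_of_isPrime hr hI hm
  · obtain ⟨a, ha, b, hb, hab⟩ := (Ideal.not_isPrime_iff.1 hI).resolve_left htop
    obtain ⟨f, hf, -⟩ := exists_isSES_quo_mul I a
    refine hf.subsingleton_pre_mid X (ih _ ?_) (ih _ ?_)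
    · refine lt_of_le_of_ne (fun x hx => Ideal.mul_mem_right a I hx) fun h => hb ?_
      rw [h]
      change b * a ∈ I
      rwa [mul_comm]
    · refine lt_of_le_of_ne le_sup_left fun h => ha ?_
      rw [h]
      exact Ideal.mem_sup_right (Ideal.mem_span_singleton_self a)

theorem subsingleton_aExt_of_residue
    (hr : ∀ (N : Type) [AddCommGroup N] [Module R N] [Module.Finite R N],
      Subsingleton (AExt R N X (r + 1)))
    (hk : Subsingleton (AExt R (R ⧸ maximalIdeal R) X r))
    (N : Type) [AddCommGroup N] [Module R N] [hN : Module.Finite R N] :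
    Subsingleton (AExt R N X r) := by
  induction hN using IsNoetherianRing.induction_on_isQuotientEquivQuotientPrime R with
  | subsingleton N => exact subsingleton_aExt_of_subsingleton_left r
  | quotient N p f =>
    exact (subsingleton_aExt_congr_left (f.trans (quoSelf p.1).symm)).2
      (subsingleton_aExt_quo hr hk _)
  | exact N₁ N₂ N₃ f g hf hg hfg h₁ h₃ =>
    exact IsSES.subsingleton_pre_mid ⟨hf, hfg, hg⟩ X h₁ h₃

end Bass

section Connecting

variable {R : Type} [CommRing R]

namespace IsSES

variable {A B C A' B' C' : Type} [AddCommGroup A] [Module R A] [AddCommGroup B] [Module R B]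
  [AddCommGroup C] [Module R C] [AddCommGroup A'] [Module R A'] [AddCommGroup B'] [Module R B']
  [AddCommGroup C'] [Module R C'] {f : A →ₗ[R] B} {g : B →ₗ[R] C} {f' : A' →ₗ[R] B'}
  {g' : B' →ₗ[R] C'} (h : IsSES f g) (h' : IsSES f' g')
  {X Y : Type} [AddCommGroup X] [Module R X] [AddCommGroup Y] [Module R Y] {n : ℕ}

/-- The connecting map in the first variable attached to a short exact sequence. -/
def conn (x : AExt R A X n) : AExt R C X (n + 1) := h.extClass.comp x (add_comm 1 n)

theorem conn_extPost (u : X →ₗ[R] Y) (x : AExt R A X n) :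
    h.conn (extPost A n u x) = extPost C (n + 1) u (h.conn x) := by
  change h.extClass.comp (x.comp (homExt u) (add_zero n)) _ =
    (h.extClass.comp x _).comp (homExt u) (add_zero (n + 1))
  rw [Abelian.Ext.comp_assoc_of_third_deg_zero]

theorem exists_of_conn_eq_zero (x : AExt R A X n) (hx : h.conn x = 0) :
    ∃ y, extPre X n f y = x :=
  Abelian.Ext.contravariant_sequence_exact₁ h.shortExact (ModuleCat.of R X) x (add_comm 1 n) hx

theorem exists_conn_eq (x : AExt R C X (n + 1)) (hx : extPre X (n + 1) g x = 0) :
    ∃ y, h.conn y = x :=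
  Abelian.Ext.contravariant_sequence_exact₃ h.shortExact (ModuleCat.of R X) x hx (add_comm 1 n)

theorem conn_extPre {a : A →ₗ[R] A'} {b : B →ₗ[R] B'} {c : C →ₗ[R] C'} (hab : f' ∘ₗ a = b ∘ₗ f)
    (hbc : g' ∘ₗ b = c ∘ₗ g) (x : AExt R A' X n) :
    h.conn (extPre X n a x) = extPre X (n + 1) c (h'.conn x) := by
  have := ShortComplex.ShortExact.extClass_naturality h.shortExact h'.shortExact
    { τ₁ := ModuleCat.ofHom a
      τ₂ := ModuleCat.ofHom b
      τ₃ := ModuleCat.ofHom c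
      comm₁₂ := ModuleCat.hom_ext hab
      comm₂₃ := ModuleCat.hom_ext hbc }
  change h.extClass.comp ((homExt a).comp x (zero_add n)) _ =
    (homExt c).comp (h'.extClass.comp x _) (zero_add (n + 1))
  rw [← Abelian.Ext.comp_assoc_of_second_deg_zero]
  refine (congrArg (fun z : AExt R C A' 1 => z.comp x (add_comm 1 n)) this).trans ?_
  exact Abelian.Ext.comp_assoc _ _ _ (zero_add 1) (add_comm 1 n) (by omega)

end IsSES

end Connecting

section Koszul

variable {R : Type} [CommRing R] [IsLocalRing R]

open IsLocalRing

theorem RegIdeal.subsingleton_ext_gt {I : Ideal R} {n : ℕ} (h : RegIdeal I n) (X : Type)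
    [AddCommGroup X] [Module R X] : ∀ i, n < i → Subsingleton (AExt R (Quo I R) X i) := by
  induction h with
  | zero =>
    intro i hi
    exact (subsingleton_aExt_congr_left (quoBot R)).2 (subsingleton_aExt_of_projective hi)
  | succ hI hy hreg ih =>
    intro i hi
    obtain ⟨i, rfl⟩ := Nat.exists_eq_add_of_le' (Nat.one_le_of_lt hi)
    exact (isSES_quo hreg).subsingleton_pre_right X (ih i (by omega)) (ih (i + 1) (by omega))

/-- Multiplication by elements regular on `R / J`, for `J` generated by a regular sequence of
length less than `n`, is injective on `G / J G`. -/
def RegularUpTo (R : Type) [CommRing R] [IsLocalRing R] (n : ℕ) (G : Type) [AddCommGroup G]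
    [Module R G] : Prop :=
  ∀ (J : Ideal R) (j : ℕ) (y : R), RegIdeal J j → j < n → y ∈ maximalIdeal R →
    IsSMulRegular (Quo J R) y → IsSMulRegular (Quo J G) y

theorem RegularUpTo.mono {n m : ℕ} (hnm : m ≤ n) {G : Type} [AddCommGroup G] [Module R G]
    (h : RegularUpTo R n G) : RegularUpTo R m G :=
  fun J j y hJ hj hy hreg => h J j y hJ (hj.trans_le hnm) hy hreg

/-- A universal class in `Ext^n(R / I, R)` for `I` generated by a regular sequence of length `n`:
classes in `Ext^n(R / I, X)` are its multiples by elements of `X`, and only the elements of `I X`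
kill it. -/
structure IsFundamentalClass (I : Ideal R) (n : ℕ) (κ : AExt R (Quo I R) R n) : Prop where
  exists_eq : ∀ (X : Type) [AddCommGroup X] [Module R X] (ξ : AExt R (Quo I R) X n),
    ∃ x : X, extPost _ n (LinearMap.toSpanSingleton R X x) κ = ξ
  mem_smul_top : ∀ (X : Type) [AddCommGroup X] [Module R X] (x : X),
    extPost _ n (LinearMap.toSpanSingleton R X x) κ = 0 → x ∈ (I • ⊤ : Submodule R X)
  exists_lift : ∀ (G : Type) [AddCommGroup G] [Module R G], RegularUpTo R n G →
    ∃ κG : AExt R (Quo I G) G n, ∀ g : G, extPost _ n (LinearMap.toSpanSingleton R G g) κ =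
      extPre _ n (quoMap I (LinearMap.toSpanSingleton R G g)) κG

theorem RegIdeal.exists_isFundamentalClass {I : Ideal R} {n : ℕ} (h : RegIdeal I n) :
    ∃ κ : AExt R (Quo I R) R n, IsFundamentalClass I n κ := by
  induction h with
  | zero =>
    refine ⟨homExt (quoBot R).toLinearMap, ?_, ?_, ?_⟩
    · intro X _ _ ξ
      obtain ⟨v, rfl⟩ := homExt_bijective.2 ξ
      refine ⟨v (quoMk ⊥ R 1), ?_⟩
      rw [extPost_homExt]
      congr 1
      refine quo_hom_ext (LinearMap.ext_ring ?_)
      simp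
    · intro X _ _ x hx
      rw [extPost_homExt, ← homExt_zero] at hx
      have := LinearMap.congr_fun (homExt_bijective.1 hx) (quoMk ⊥ R 1)
      simpa using this
    · intro G _ _ _
      refine ⟨homExt (quoBot G).toLinearMap, fun g => ?_⟩
      rw [extPost_homExt, extPre_homExt]
      exact congrArg homExt (quo_hom_ext (by ext; simp))
  | @succ I n y hI hy hreg ih =>
    obtain ⟨κ, hκ⟩ := ih
    have hS := isSES_quo hreg
    refine ⟨hS.conn κ, ?_, ?_, ?_⟩
    · intro X _ _ ξ
      have := hI.subsingleton_ext_gt X (n + 1) (Nat.lt_succ_self n)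
      obtain ⟨η, rfl⟩ := hS.exists_conn_eq ξ (Subsingleton.elim _ _)
      obtain ⟨x, rfl⟩ := hκ.exists_eq X η
      exact ⟨x, (hS.conn_extPost _ _).symm⟩
    · intro X _ _ x hx
      rw [← hS.conn_extPost] at hx
      obtain ⟨θ, hθ⟩ := hS.exists_of_conn_eq_zero _ hx
      obtain ⟨b, rfl⟩ := hκ.exists_eq X θ
      rw [mem_sup_span_smul_top]
      refine ⟨b, hκ.mem_smul_top X _ ?_⟩
      have : LinearMap.toSpanSingleton R X (x - y • b) =
          LinearMap.toSpanSingleton R X x + (-y) • LinearMap.toSpanSingleton R X b := by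
        ext; simp [sub_eq_add_neg]
      rw [this, extPost_add, extPost_smul, ← hθ, extPre_smul, extPre_id]
      simp
    · intro G _ _ hG
      obtain ⟨κG, hκG⟩ := hκ.exists_lift G (hG.mono (Nat.le_succ n))
      have hSG := isSES_quo (hG I n y hI (Nat.lt_succ_self n) hy hreg)
      refine ⟨hSG.conn κG, fun g => ?_⟩
      rw [← hS.conn_extPost, hκG g]
      refine hS.conn_extPre hSG (b := quoMap I (LinearMap.toSpanSingleton R G g)) ?_ ?_ κG
      · ext; simp
      · refine quo_hom_ext ?_
        ext; simp

theorem RegIdeal.exists_residue_injective {I : Ideal R} {t : ℕ} (h : RegIdeal I t)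
    (ht : ¬ Subsingleton (AExt R (R ⧸ maximalIdeal R) R t)) :
    ∃ s : (R ⧸ maximalIdeal R) →ₗ[R] Quo I R, Function.Injective s := by
  have := h.nontrivial_ext ht 0 (zero_add t)
  rw [subsingleton_aExt_zero_iff, not_subsingleton_iff_nontrivial] at this
  obtain ⟨s, hs⟩ := exists_ne (0 : (R ⧸ maximalIdeal R) →ₗ[R] Quo I R)
  have : IsSimpleModule R (R ⧸ maximalIdeal R) :=
    isSimpleModule_iff_isCoatom.2 (maximalIdeal.isMaximal R).out
  exact ⟨s, s.injective_of_ne_zero hs⟩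

variable [IsNoetherianRing R]

/-- Vanishing of `Ext^i(-, X)` on finite modules for large `i`. -/
def FinInjDim (R : Type) [CommRing R] (X : Type) [AddCommGroup X] [Module R X] : Prop :=
  ∃ D : ℕ, ∀ i, D < i → ∀ (N : Type) [AddCommGroup N] [Module R N] [Module.Finite R N],
    Subsingleton (AExt R N X i)

variable {X : Type} [AddCommGroup X] [Module R X] [Module.Finite R X] {I : Ideal R} {t : ℕ}

theorem FinInjDim.subsingleton_ext (hX : FinInjDim R X) (h : RegIdeal I t)
    (ht : ¬ Subsingleton (AExt R (R ⧸ maximalIdeal R) R t)) :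
    ∀ i, t < i → ∀ (N : Type) [AddCommGroup N] [Module R N] [Module.Finite R N],
      Subsingleton (AExt R N X i) := by
  obtain ⟨D, hD⟩ := hX
  replace hD : ∀ i, t < i → D < i → ∀ (N : Type) [AddCommGroup N] [Module R N]
    [Module.Finite R N], Subsingleton (AExt R N X i) := fun i _ => hD i
  obtain ⟨s, hs⟩ := h.exists_residue_injective ht
  have hses : IsSES s (LinearMap.range s).mkQ :=
    ⟨hs, s.exact_map_mkQ_range, Submodule.mkQ_surjective _⟩
  induction D with
  | zero => exact fun i hi => hD i hi (by omega)
  | succ D ih =>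
    refine ih fun i hti hi => ?_
    have hnext := hD (i + 1) (by omega) (by omega)
    exact subsingleton_aExt_of_residue hnext
      (hses.subsingleton_pre_left X (h.subsingleton_ext_gt X i hti) (hnext _))

theorem FinInjDim.subsingleton_of_ext_residue (hX : FinInjDim R X) (h : RegIdeal I t)
    (ht : ¬ Subsingleton (AExt R (R ⧸ maximalIdeal R) R t))
    (hk : Subsingleton (AExt R (R ⧸ maximalIdeal R) X t)) : Subsingleton X := by
  have := subsingleton_aExt_of_residue (hX.subsingleton_ext h ht (t + 1) (Nat.lt_succ_self t)) hk
    (Quo I R)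
  obtain ⟨κ, hκ⟩ := h.exists_isFundamentalClass
  have htop : (⊤ : Submodule R X) ≤ I • ⊤ := fun x _ =>
    hκ.mem_smul_top X x (Subsingleton.elim _ _)
  rw [← Submodule.subsingleton_iff R, ← subsingleton_iff_bot_eq_top, eq_comm]
  exact Submodule.eq_bot_of_le_smul_of_le_jacobson_bot I ⊤ Module.Finite.fg_top htop
    (h.le_maximalIdeal.trans (maximalIdeal_le_jacobson _))

end Koszul

section HomReduction

variable {R : Type} [CommRing R]

theorem IsSES.exists_factor {A B C X : Type} [AddCommGroup A] [Module R A] [AddCommGroup B]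
    [Module R B] [AddCommGroup C] [Module R C] [AddCommGroup X] [Module R X] {f : A →ₗ[R] B}
    {g : B →ₗ[R] C} (h : IsSES f g) (w : X →ₗ[R] B) (hw : g ∘ₗ w = 0) :
    ∃ v : X →ₗ[R] A, f ∘ₗ v = w := by
  obtain ⟨y, hy⟩ := h.post_exact X (homExt w) (by rw [extPost_homExt, hw, homExt_zero])
  obtain ⟨v, rfl⟩ := homExt_bijective.2 y
  exact ⟨v, homExt_bijective.1 (by rw [← hy, extPost_homExt])⟩

variable {G C N : Type} [AddCommGroup G] [Module R G] [AddCommGroup C] [Module R C]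
  [AddCommGroup N] [Module R N] (u : G →ₗ[R] C →ₗ[R] N)

/-- The map `G / I G → Hom(C, N / I N)` induced by a map `G → Hom(C, N)`. -/
def quoHom (I : Ideal R) : Quo I G →ₗ[R] C →ₗ[R] Quo I N :=
  Submodule.liftQ _ (LinearMap.llcomp R C N (Quo I N) (quoMk I N) ∘ₗ u)
    (Submodule.smul_le.2 fun r hr g _ => by
      ext c
      simpa using smul_quo_eq_zero hr (quoMk I N (u g c)))

@[simp]
theorem quoHom_quoMk (I : Ideal R) (g : G) : quoHom u I (quoMk I G g) = quoMk I N ∘ₗ u g := rfl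

theorem quoHom_bot_bijective (hu : Function.Bijective u) :
    Function.Bijective (quoHom u (⊥ : Ideal R)) := by
  constructor
  · refine (injective_iff_map_eq_zero _).2 fun x hx => ?_
    obtain ⟨g, rfl⟩ := quoMk_surjective ⊥ x
    have : u g = 0 := by
      ext c
      exact (quoBot N).symm.map_eq_zero_iff.1 (LinearMap.congr_fun hx c)
    rw [(injective_iff_map_eq_zero _).1 hu.1 g this, map_zero]
  · intro w
    obtain ⟨g, hg⟩ := hu.2 ((quoBot N).toLinearMap ∘ₗ w)
    refine ⟨quoMk ⊥ G g, ?_⟩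
    rw [quoHom_quoMk, hg]
    ext c
    exact (quoBot N).symm_apply_apply (w c)

variable {u} {I : Ideal R} {y : R}

theorem quoHom_sup_injective (hu : Function.Bijective (quoHom u I))
    (hy : IsSMulRegular (Quo I N) y) :
    Function.Injective (quoHom u (I ⊔ Ideal.span {y})) := by
  refine (injective_iff_map_eq_zero _).2 fun x hx => ?_
  obtain ⟨g, rfl⟩ := quoMk_surjective _ x
  obtain ⟨v, hv⟩ := (isSES_quo hy).exists_factor (quoHom u I (quoMk I G g)) hx
  obtain ⟨z, rfl⟩ := hu.2 v
  obtain ⟨b, rfl⟩ := quoMk_surjective _ z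
  rw [quoMk_sup_eq_zero_iff]
  refine ⟨b, hu.1 ?_⟩
  rw [← hv, map_smul]
  ext c
  simp

theorem quoHom_sup_surjective (hu : Function.Surjective (quoHom u I))
    (hy : IsSMulRegular (Quo I N) y) (hC : Subsingleton (AExt R C (Quo I N) 1)) :
    Function.Surjective (quoHom u (I ⊔ Ideal.span {y})) := by
  intro w
  obtain ⟨v, rfl⟩ := (isSES_quo hy).exists_lift C hC w
  obtain ⟨x, rfl⟩ := hu v
  obtain ⟨g, rfl⟩ := quoMk_surjective _ x
  exact ⟨quoMk _ G g, rfl⟩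

theorem isSMulRegular_quo_of_quoHom_injective (hu : Function.Injective (quoHom u I))
    (hy : IsSMulRegular (Quo I N) y) : IsSMulRegular (Quo I G) y := by
  rw [isSMulRegular_iff_right_eq_zero_of_smul] at hy ⊢
  intro x hx
  refine (injective_iff_map_eq_zero _).1 hu x (LinearMap.ext fun c => hy _ ?_)
  rw [← LinearMap.smul_apply, ← map_smul, hx, map_zero, LinearMap.zero_apply]

theorem isSMulRegular_quo_of_quoHom_bijective [IsNoetherianRing R] [Module.Finite R C]
    [Module.Finite R N] (hC : Module.annihilator R C = ⊥) (hu : Function.Bijective (quoHom u I))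
    (hy : IsSMulRegular (Quo I G) y) : IsSMulRegular (Quo I N) y := by
  rw [isSMulRegular_iff_right_eq_zero_of_smul] at hy ⊢
  set Z : Submodule R (Quo I N) := LinearMap.ker (y • LinearMap.id)
  have hsub : Subsingleton (C →ₗ[R] Z) := by
    refine subsingleton_of_forall_eq 0 fun φ => ?_
    obtain ⟨x, hx⟩ := hu.2 (Z.subtype ∘ₗ φ)
    have hx0 : x = 0 := by
      refine hy x (hu.1 ?_)
      rw [map_smul, hx, map_zero]
      ext c
      exact (φ c).2
    ext c
    rw [hx0, map_zero] at hx
    exact (LinearMap.congr_fun hx c).symm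
  obtain ⟨r, hr, hreg⟩ := IsSMulRegular.subsingleton_linearMap_iff.1 hsub
  rw [hC, Submodule.mem_bot] at hr
  rw [hr, isSMulRegular_iff_right_eq_zero_of_smul] at hreg
  intro x hx
  exact congrArg Subtype.val (hreg ⟨x, hx⟩ (zero_smul R _))

end HomReduction

section HomChain

variable {R : Type} [CommRing R] [IsLocalRing R]

open IsLocalRing

variable {G C N : Type} [AddCommGroup G] [Module R G] [AddCommGroup C] [Module R C]
  [AddCommGroup N] [Module R N] {u : G →ₗ[R] C →ₗ[R] N}

theorem regularUpTo_self (n : ℕ) : RegularUpTo R n R := fun _ _ _ _ _ _ h => h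

section

variable [IsNoetherianRing R] [Module.Finite R C] [Module.Finite R N]
  (hC : Module.annihilator R C = ⊥) (hu : Function.Bijective u)
  (hext : ∀ i, 1 ≤ i → Subsingleton (AExt R C N i))

include hC hu hext

theorem RegIdeal.quoHom_bijective {n j : ℕ} (hG : RegularUpTo R n G) {I : Ideal R}
    (hI : RegIdeal I j) (hj : j ≤ n) : Function.Bijective (quoHom u I) ∧
      ∀ i, 1 ≤ i → Subsingleton (AExt R C (Quo I N) i) := by
  induction hI with
  | zero =>
    exact ⟨quoHom_bot_bijective u hu, fun i hi => subsingleton_aExt_of_retract_right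
      (quoBot N).toLinearMap (quoBot N).symm.toLinearMap (by ext; simp) (hext i hi)⟩
  | @succ I j y hI hy hreg ih =>
    obtain ⟨hb, he⟩ := ih (by omega)
    have hyN := isSMulRegular_quo_of_quoHom_bijective hC hb (hG I j y hI hj hy hreg)
    exact ⟨⟨quoHom_sup_injective hb hyN, quoHom_sup_surjective hb.2 hyN (he 1 le_rfl)⟩,
      fun i hi => (isSES_quo hyN).subsingleton_post_right C (he i hi) (he (i + 1) (by omega))⟩

end

theorem RegIdeal.quoHom_injective {n j d : ℕ} (hnd : n ≤ d) (hu : Function.Bijective u)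
    (hext : ∀ i, 1 ≤ i → i ≤ d - 1 → Subsingleton (AExt R C N i)) (hN : RegularUpTo R n N)
    {I : Ideal R} (hI : RegIdeal I j) (hj : j ≤ n) : Function.Injective (quoHom u I) ∧
      (j + 1 ≤ d → Function.Surjective (quoHom u I)) ∧
      ∀ i, 1 ≤ i → i + j ≤ d - 1 → Subsingleton (AExt R C (Quo I N) i) := by
  induction hI with
  | zero =>
    have hb := quoHom_bot_bijective u hu
    exact ⟨hb.1, fun _ => hb.2, fun i hi hid => subsingleton_aExt_of_retract_right
      (quoBot N).toLinearMap (quoBot N).symm.toLinearMap (by ext; simp) (hext i hi hid)⟩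
  | @succ I j y hI hy hreg ih =>
    obtain ⟨hi, hs, he⟩ := ih (by omega)
    have hyN := hN I j y hI hj hy hreg
    exact ⟨quoHom_sup_injective ⟨hi, hs (by omega)⟩ hyN,
      fun hjd => quoHom_sup_surjective (hs (by omega)) hyN (he 1 le_rfl (by omega)),
      fun i hi hid => (isSES_quo hyN).subsingleton_post_right C (he i hi (by omega))
        (he (i + 1) (by omega) (by omega))⟩

theorem RegularUpTo.of_quoHom_injective {n d : ℕ} (hnd : n ≤ d) (hu : Function.Bijective u)
    (hext : ∀ i, 1 ≤ i → i ≤ d - 1 → Subsingleton (AExt R C N i)) (hN : RegularUpTo R n N) :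
    RegularUpTo R n G :=
  fun I j y hI hj hy hreg => isSMulRegular_quo_of_quoHom_injective
    (hI.quoHom_injective hnd hu hext hN hj.le).1 (hN I j y hI hj hy hreg)

end HomChain

section Presentation

variable {R : Type} [CommRing R]

theorem IsSES.exists_desc {A B C X : Type} [AddCommGroup A] [Module R A] [AddCommGroup B]
    [Module R B] [AddCommGroup C] [Module R C] [AddCommGroup X] [Module R X] {f : A →ₗ[R] B}
    {g : B →ₗ[R] C} (h : IsSES f g) (w : B →ₗ[R] X) (hw : w ∘ₗ f = 0) :
    ∃ v : C →ₗ[R] X, v ∘ₗ g = w := by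
  obtain ⟨y, hy⟩ := h.pre_exact X (homExt w) (by rw [extPre_homExt, hw, homExt_zero])
  obtain ⟨v, rfl⟩ := homExt_bijective.2 y
  exact ⟨v, homExt_bijective.1 (by rw [← hy, extPre_homExt])⟩

theorem isSES_range_subtype {A B : Type} [AddCommGroup A] [Module R A] [AddCommGroup B]
    [Module R B] (f : A →ₗ[R] B) :
    IsSES (LinearMap.range f).subtype (LinearMap.range f).mkQ :=
  ⟨Submodule.subtype_injective _, LinearMap.exact_subtype_mkQ _, Submodule.mkQ_surjective _⟩

theorem isSES_ker_subtype {A B : Type} [AddCommGroup A] [Module R A] [AddCommGroup B]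
    [Module R B] {f : A →ₗ[R] B} (hf : Function.Surjective f) :
    IsSES (LinearMap.ker f).subtype f :=
  ⟨Submodule.subtype_injective _, LinearMap.exact_subtype_ker_map f, hf⟩

/-- If a linear form `ω` on `A^n` vanishes on the solutions of a linear system `T`, then, as soon
as `Ext^{r+1}(-, X)` vanishes, multiplication by `ω` on `Ext^r(A, X)` is a combination of the
equations of the system. -/
theorem exists_smul_eq_sum {A X : Type} [AddCommGroup A] [Module R A] [Module.Finite R A]
    [AddCommGroup X] [Module R X] {r b₀ b₁ : ℕ}
    (hr : ∀ (N : Type) [AddCommGroup N] [Module R N] [Module.Finite R N],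
      Subsingleton (AExt R N X (r + 1)))
    (T : Fin b₁ → Fin b₀ → R) (ω : Fin b₀ → R)
    (hω : ∀ a : Fin b₀ → A, (∀ i, ∑ j, T i j • a j = 0) → ∑ j, ω j • a j = 0)
    (ξ : AExt R A X r) :
    ∃ η : Fin b₁ → AExt R A X r, ∀ j, ω j • ξ = ∑ i, T i j • η i := by
  set τ : (Fin b₀ → A) →ₗ[R] (Fin b₁ → A) :=
    LinearMap.pi fun i => ∑ j, T i j • LinearMap.proj j with hτ
  set ω' : (Fin b₀ → A) →ₗ[R] A := ∑ j, ω j • LinearMap.proj j with hω'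
  obtain ⟨v, hv⟩ := (isSES_ker_subtype τ.surjective_rangeRestrict).exists_desc ω' (by
    ext ⟨a, ha⟩
    have ha' : τ a = 0 := congrArg Subtype.val ha
    have := hω a fun i => by simpa [hτ] using congrFun ha' i
    simpa [hω'] using this)
  obtain ⟨θ, hθ⟩ := (isSES_range_subtype τ).pre_surjective X (hr _) (extPre X r v ξ)
  refine ⟨fun i => extPre X r (LinearMap.single R (fun _ => A) i) θ, fun j => ?_⟩
  have h1 : ω' ∘ₗ LinearMap.single R (fun _ => A) j = ω j • LinearMap.id := by
    ext a
    simp [hω', Pi.single_apply]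
  have h2 : τ ∘ₗ LinearMap.single R (fun _ => A) j =
      ∑ i, T i j • LinearMap.single R (fun _ => A) i := by
    ext a i
    simp [hτ, Pi.single_apply]
  calc ω j • ξ = extPre X r (LinearMap.single R (fun _ => A) j) (extPre X r ω' ξ) := by
        rw [extPre_comp, h1, extPre_smul, extPre_id]
    _ = extPre X r (LinearMap.single R (fun _ => A) j) (extPre X r τ θ) := by
        rw [← hv, ← extPre_comp, ← hθ, extPre_comp r (LinearMap.range τ).subtype]
        rfl
    _ = ∑ i, T i j • extPre X r (LinearMap.single R (fun _ => A) i) θ := by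
        rw [extPre_comp, h2, extPre_sum]
        simp only [extPre_smul]

theorem exists_presentation [IsNoetherianRing R] (M : Type) [AddCommGroup M] [Module R M]
    [Module.Finite R M] :
    ∃ (b₀ b₁ : ℕ) (m : Fin b₀ → M) (T : Fin b₁ → Fin b₀ → R),
      (∀ w, ∃ ω : Fin b₀ → R, w = ∑ j, ω j • m j) ∧ (∀ i, ∑ j, T i j • m j = 0) ∧
      ∀ (A : Type) [AddCommGroup A] [Module R A] (a : Fin b₀ → A),
        (∀ i, ∑ j, T i j • a j = 0) → ∃ g : M →ₗ[R] A, ∀ j, g (m j) = a j := by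
  obtain ⟨b₀, p, hp⟩ := Module.Finite.exists_fin' R M
  obtain ⟨b₁, q, hq⟩ := Module.Finite.exists_fin' R (LinearMap.ker p)
  have hsum : ∀ ω : Fin b₀ → R, p ω = ∑ j, ω j • p (Pi.single j 1) := fun ω => by
    conv_lhs => rw [pi_eq_sum_univ' ω]
    simp only [map_sum, map_smul]
  refine ⟨b₀, b₁, fun j => p (Pi.single j 1), fun i => (q (Pi.single i 1) : Fin b₀ → R),
    fun w => ?_, fun i => ?_, fun A _ _ a ha => ?_⟩
  · obtain ⟨ω, rfl⟩ := hp w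
    exact ⟨ω, hsum ω⟩
  · rw [← hsum]
    exact (q (Pi.single i 1)).2
  · obtain ⟨g, hg⟩ := (isSES_ker_subtype hp).exists_desc (Fintype.linearCombination R a) (by
      have : (Fintype.linearCombination R a ∘ₗ (LinearMap.ker p).subtype) ∘ₗ q = 0 := by
        ext i
        simpa [Fintype.linearCombination_apply] using ha i
      ext x
      obtain ⟨z, rfl⟩ := hq x
      exact LinearMap.congr_fun this z)
    refine ⟨g, fun j => ?_⟩
    rw [← LinearMap.comp_apply, hg, Fintype.linearCombination_apply_single, one_smul]

end Presentation

section EndTensor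

variable (R : Type) [CommRing R] (C M : Type) [AddCommGroup C] [Module R C] [AddCommGroup M]
  [Module R M]

/-- Evaluation at `m` on `C ⊗ End(M)`. -/
def tensorEval (m : M) : TensorProduct R C (M →ₗ[R] M) →ₗ[R] TensorProduct R C M :=
  LinearMap.lTensor C ((LinearMap.id : (M →ₗ[R] M) →ₗ[R] M →ₗ[R] M).flip m)

@[simp]
theorem tensorEval_tmul (m : M) (c : C) (h : M →ₗ[R] M) :
    tensorEval R C M m (TensorProduct.tmul R c h) = TensorProduct.tmul R c (h m) := rfl

theorem sum_smul_tensorEval {ι : Type*} (s : Finset ι) (r : ι → R) (m : ι → M) :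
    ∑ j ∈ s, r j • tensorEval R C M (m j) = tensorEval R C M (∑ j ∈ s, r j • m j) := by
  ext c h
  simp [TensorProduct.tmul_sum]

variable {R C M}

theorem exists_apply_id_eq (x : TensorProduct R C (M →ₗ[R] M)) :
    ∃ ψ : (M →ₗ[R] M) →ₗ[R] TensorProduct R C (M →ₗ[R] M), ψ LinearMap.id = x := by
  induction x using TensorProduct.induction_on with
  | zero => exact ⟨0, rfl⟩
  | tmul c h => exact ⟨TensorProduct.mk R C _ c ∘ₗ LinearMap.llcomp R M M M h, rfl⟩
  | add x y hx hy =>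
    obtain ⟨ψ, rfl⟩ := hx
    obtain ⟨ψ', rfl⟩ := hy
    exact ⟨ψ + ψ', rfl⟩

end EndTensor

section Torsionless

variable {R : Type} [CommRing R] [IsLocalRing R]

open IsLocalRing

theorem RegIdeal.exists_lift {M : Type} [AddCommGroup M] [Module R M] {d : ℕ}
    (hext : ∀ j, 1 ≤ j → j ≤ d → Subsingleton (AExt R M R j)) {J : Ideal R} {n : ℕ}
    (hJ : RegIdeal J n) (hn : n ≤ d) :
    (∀ j, 1 ≤ j → j + n ≤ d → Subsingleton (AExt R M (Quo J R) j)) ∧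
      ∀ g : M →ₗ[R] Quo J R, ∃ f : M →ₗ[R] R, quoMk J R ∘ₗ f = g := by
  induction hJ with
  | zero =>
    refine ⟨fun j hj hjd => subsingleton_aExt_of_retract_right (quoBot R).toLinearMap
      (quoBot R).symm.toLinearMap (by ext; simp) (hext j hj hjd),
      fun g => ⟨(quoBot R).toLinearMap ∘ₗ g, ?_⟩⟩
    ext m
    exact (quoBot R).symm_apply_apply (g m)
  | succ hI hy hreg ih =>
    obtain ⟨he, hl⟩ := ih (by omega)
    have hS := isSES_quo hreg
    refine ⟨fun j hj hjd => hS.subsingleton_post_right M (he j hj (by omega))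
      (he (j + 1) (by omega) (by omega)), fun g => ?_⟩
    obtain ⟨g, rfl⟩ := hS.exists_lift M (he 1 le_rfl (by omega)) g
    obtain ⟨f, rfl⟩ := hl g
    exact ⟨f, rfl⟩

variable [IsNoetherianRing R] {d t : ℕ} {C M : Type} [AddCommGroup C] [Module R C]
  [Module.Finite R C] [AddCommGroup M] [Module R M] [Module.Finite R M]
  (ht : ¬ Subsingleton (AExt R (R ⧸ maximalIdeal R) R t))
  (hX : FinInjDim R (TensorProduct R C (M →ₗ[R] M)))

include ht hX

theorem tmul_mem_smul_top_of_forall_quo {J : Ideal R} (hJ : RegIdeal J t) {w : M}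
    (hw : ∀ g : M →ₗ[R] Quo J R, g w = 0) (c : C) :
    TensorProduct.tmul R c w ∈ (J • ⊤ : Submodule R (TensorProduct R C M)) := by
  obtain ⟨κ, hκ⟩ := hJ.exists_isFundamentalClass
  obtain ⟨b₀, b₁, m, T, hspan, hrel, hdesc⟩ := exists_presentation (R := R) M
  obtain ⟨ω, rfl⟩ := hspan w
  set ξ : AExt R (Quo J R) (TensorProduct R C (M →ₗ[R] M)) t :=
    extPost _ t (LinearMap.toSpanSingleton R _ (TensorProduct.tmul R c LinearMap.id)) κ
  obtain ⟨η, hη⟩ := exists_smul_eq_sum (hX.subsingleton_ext hJ ht (t + 1) (Nat.lt_succ_self t))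
    T ω (fun a ha => by
      obtain ⟨g, hg⟩ := hdesc _ a ha
      simpa [hg] using hw g) ξ
  refine hκ.mem_smul_top _ _ ?_
  calc extPost _ t (LinearMap.toSpanSingleton R _ (TensorProduct.tmul R c (∑ j, ω j • m j))) κ
      = extPost _ t (tensorEval R C M (∑ j, ω j • m j)) ξ := by
        rw [extPost_comp, LinearMap.comp_toSpanSingleton]; rfl
    _ = ∑ j, extPost _ t (tensorEval R C M (m j)) (ω j • ξ) := by
        rw [← sum_smul_tensorEval, extPost_sum]
        simp only [extPost_smul, map_smul]
    _ = ∑ j, ∑ i, T i j • extPost _ t (tensorEval R C M (m j)) (η i) := by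
        simp only [hη, map_sum, map_smul]
    _ = ∑ i, extPost _ t (tensorEval R C M (∑ j, T i j • m j)) (η i) := by
        rw [Finset.sum_comm]
        simp only [← sum_smul_tensorEval, extPost_sum, extPost_smul]
    _ = 0 := by
        refine Finset.sum_eq_zero fun i _ => ?_
        have : tensorEval R C M 0 = 0 := by ext; simp
        rw [hrel i, this, extPost_zero]

variable (htd : t ≤ d) (hT : ∀ i < t, Subsingleton (AExt R (R ⧸ maximalIdeal R) R i))
  (hextR : ∀ j, 1 ≤ j → j ≤ d → Subsingleton (AExt R M R j))

include htd hT hextR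

theorem tmul_mem_smul_top_of_forall_mem {I : Ideal R} {n : ℕ} (hI : RegIdeal I n) (hn : n ≤ t)
    {w : M} (hw : ∀ f : M →ₗ[R] R, f w ∈ I) (c : C) :
    TensorProduct.tmul R c w ∈ (I • ⊤ : Submodule R (TensorProduct R C M)) := by
  rw [← quoMk_eq_zero_iff, ← Submodule.mem_bot R,
    ← (maximalIdeal R).iInf_pow_smul_eq_bot_of_isLocalRing (maximalIdeal.isMaximal R).ne_top,
    Submodule.mem_iInf]
  intro a
  obtain ⟨J, hJ, hIJ, hJa⟩ := hI.exists_extension hT hn a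
  have hmem := tmul_mem_smul_top_of_forall_quo ht hX hJ (w := w) (fun g => by
    obtain ⟨f, rfl⟩ := (hJ.exists_lift hextR htd).2 g
    exact quoMk_eq_zero_iff.2 (mem_smul_top_self.2 (hIJ (hw f)))) c
  have hmem := Submodule.smul_mono_left hJa hmem
  rw [Submodule.sup_smul, Submodule.mem_sup] at hmem
  obtain ⟨x, hx, z, hz, hxz⟩ := hmem
  rw [← hxz, map_add, quoMk_eq_zero_iff.2 hx, zero_add]
  have := Submodule.mem_map_of_mem (f := quoMk I (TensorProduct R C M)) hz
  rw [Submodule.map_smul''] at this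
  exact Submodule.smul_mono le_rfl le_top this

variable (hC : Module.annihilator R C = ⊥)
  (hM : Function.Bijective (TensorProduct.mk R C M).flip)
  (hCM : ∀ i, 1 ≤ i → Subsingleton (AExt R C (TensorProduct R C M) i))

include hC hM hCM

theorem mem_smul_top_of_forall_mem {I : Ideal R} {n : ℕ} (hI : RegIdeal I n) (hn : n ≤ t)
    (hreg : RegularUpTo R n M) {w : M} (hw : ∀ f : M →ₗ[R] R, f w ∈ I) :
    w ∈ (I • ⊤ : Submodule R M) := by
  have hb := (hI.quoHom_bijective hC hM hCM hreg le_rfl).1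
  rw [← quoMk_eq_zero_iff]
  refine (injective_iff_map_eq_zero _).1 hb.1 _ (LinearMap.ext fun c => ?_)
  exact quoMk_eq_zero_iff.2
    (tmul_mem_smul_top_of_forall_mem ht hX htd hT hextR hI hn hw c)

theorem regularUpTo_depth : RegularUpTo R t M := by
  suffices ∀ n ≤ t, RegularUpTo R n M from this t le_rfl
  intro n
  induction n with
  | zero => exact fun _ J j y hJ hj => absurd hj (Nat.not_lt_zero j)
  | succ n ih =>
    intro hn I j y hI hj hy hreg
    rw [isSMulRegular_iff_right_eq_zero_of_smul] at hreg ⊢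
    intro x hx
    obtain ⟨m, rfl⟩ := quoMk_surjective I x
    rw [← map_smul, quoMk_eq_zero_iff] at hx
    rw [quoMk_eq_zero_iff]
    refine mem_smul_top_of_forall_mem ht hX htd hT hextR hC hM hCM hI (by omega)
      ((ih (by omega)).mono (Nat.le_of_lt_succ hj)) fun f => ?_
    rw [← mem_smul_top_self, ← quoMk_eq_zero_iff]
    apply hreg
    rw [← map_smul, quoMk_eq_zero_iff, ← map_smul]
    exact smul_top_le_comap I f hx

variable [Nontrivial M]
  (hextM : ∀ i, 1 ≤ i → i ≤ d - 1 → Subsingleton (AExt R M M i))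

include hextM

theorem exists_isUnit_apply : ∃ (f : M →ₗ[R] R) (m : M), IsUnit (f m) := by
  by_contra! hmax
  obtain ⟨I, hI, -⟩ := exists_regIdeal hT 0
  obtain ⟨s, hs⟩ := hI.exists_residue_injective ht
  obtain ⟨κ, hκ⟩ := hI.exists_isFundamentalClass
  obtain ⟨a, ha⟩ := quoMk_surjective I (s 1)
  have hregM := regularUpTo_depth ht hX htd hT hextR hC hM hCM
  have hid : Function.Bijective (LinearMap.id : (M →ₗ[R] M) →ₗ[R] M →ₗ[R] M) :=
    Function.bijective_id
  have hregH := RegularUpTo.of_quoHom_injective htd hid hextM hregM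
  have haM : ∀ w : M, a • w ∈ (I • ⊤ : Submodule R M) := fun w => by
    refine mem_smul_top_of_forall_mem ht hX htd hT hextR hC hM hCM hI le_rfl hregM fun f => ?_
    have hfw : f w ∈ maximalIdeal R := hmax f w
    have hcomm : f (a • w) = f w • a := by simp [mul_comm]
    rw [← mem_smul_top_self, ← quoMk_eq_zero_iff, hcomm, map_smul, ha, ← map_smul]
    have : f w • (1 : R ⧸ maximalIdeal R) = 0 :=
      Ideal.Quotient.eq_zero_iff_mem.2 (Ideal.mul_mem_right 1 _ hfw)
    rw [this, map_zero]
  have haH : quoMk I (M →ₗ[R] M) (a • LinearMap.id) = 0 := by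
    refine (injective_iff_map_eq_zero _).1
      (hI.quoHom_injective htd hid hextM hregM le_rfl).1 _ (LinearMap.ext fun w => ?_)
    exact quoMk_eq_zero_iff.2 (haM w)
  obtain ⟨κH, hκH⟩ := hκ.exists_lift _ hregH
  have hzero : extPre _ t s
      (extPost _ t (LinearMap.toSpanSingleton R (M →ₗ[R] M) LinearMap.id) κ) = 0 := by
    have : quoMap I (LinearMap.toSpanSingleton R (M →ₗ[R] M) LinearMap.id) ∘ₗ s = 0 := by
      refine Submodule.linearMap_qext _ (LinearMap.ext_ring ?_)
      change quoMap I _ (s 1) = 0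
      rw [← ha, quoMap_quoMk]
      exact haH
    rw [hκH, extPre_comp, this, extPre_zero]
  have hk : Subsingleton (AExt R (R ⧸ maximalIdeal R) (TensorProduct R C (M →ₗ[R] M)) t) := by
    have hses : IsSES s (LinearMap.range s).mkQ :=
      ⟨hs, s.exact_map_mkQ_range, Submodule.mkQ_surjective _⟩
    refine subsingleton_of_forall_eq 0 fun ζ => ?_
    obtain ⟨ξ, rfl⟩ := hses.pre_surjective _
      (hX.subsingleton_ext hI ht (t + 1) (Nat.lt_succ_self t) _) ζ
    obtain ⟨x, rfl⟩ := hκ.exists_eq _ ξ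
    obtain ⟨ψ, rfl⟩ := exists_apply_id_eq x
    rw [← LinearMap.comp_toSpanSingleton, ← extPost_comp, extPre_extPost, hzero, map_zero]
  have := hX.subsingleton_of_ext_residue hI ht hk
  refine not_subsingleton M (subsingleton_of_forall_eq 0 fun m => ?_)
  refine (injective_iff_map_eq_zero _).1 hM.1 m (LinearMap.ext fun c => ?_)
  change TensorProduct.tmul R c m = 0
  have : tensorEval R C M m (TensorProduct.tmul R c LinearMap.id) = 0 := by
    rw [Subsingleton.elim (TensorProduct.tmul R c (LinearMap.id : M →ₗ[R] M)) 0, map_zero]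
  simpa using this

end Torsionless

section CohenMacaulay

open IsLocalRing

variable {R : Type} [CommRing R] [IsNoetherianRing R] [IsLocalRing R]

theorem exists_mem_associatedPrimes_ne_maximalIdeal {N : Type} [AddCommGroup N] [Module R N]
    [Module.Finite R N] (hN : 0 < Module.supportDim R N) :
    ∃ p ∈ associatedPrimes R N, p ≠ maximalIdeal R := by
  by_contra! h
  refine hN.not_ge ?_
  have : Subsingleton (Module.support R N) := by
    suffices ∀ p ∈ Module.support R N, p.asIdeal = maximalIdeal R from
      ⟨fun p q => Subtype.ext (PrimeSpectrum.ext ((this p p.2).trans (this q q.2).symm))⟩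
    intro p hp
    rw [Module.mem_support_iff_of_finite] at hp
    obtain ⟨q, hq, hqp⟩ := Ideal.exists_minimalPrimes_le hp
    rw [h q (Module.associatedPrimes.minimalPrimes_annihilator_subset_associatedPrimes R N hq)]
      at hqp
    exact le_antisymm (le_maximalIdeal p.isPrime.ne_top) hqp
  exact Order.krullDim_nonpos_of_subsingleton

omit [IsLocalRing R] in
theorem exists_comap_eq_of_mem_associatedPrimes {I p : Ideal R}
    (hp : p ∈ associatedPrimes R (Quo I R)) :
    ∃ a : R, Submodule.comap (LinearMap.toSpanSingleton R R a) I = p := by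
  obtain ⟨-, x, hx⟩ := isAssociatedPrime_iff.1 (AssociatedPrimes.mem_iff.1 hp)
  obtain ⟨a, rfl⟩ := quoMk_surjective I x
  refine ⟨a, ?_⟩
  rw [hx]
  ext r
  rw [Submodule.mem_colon_singleton, ← map_smul, Submodule.mem_bot, quoMk_eq_zero_iff,
    mem_smul_top_self]
  rfl

theorem FinInjDim.depth_eq_ringKrullDim {C : Type} [AddCommGroup C] [Module R C]
    [Module.Finite R C] (hinj : FinInjDim R C) {d t : ℕ} (hd : ringKrullDim R = d)
    (htd : t ≤ d) (hT : ∀ i < t, Subsingleton (AExt R (R ⧸ maximalIdeal R) R i))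
    (ht : ¬ Subsingleton (AExt R (R ⧸ maximalIdeal R) R t))
    (hC : Function.Bijective (LinearMap.lsmul R C)) (hann : Module.annihilator R C = ⊥)
    (hext : ∀ i, 1 ≤ i → Subsingleton (AExt R C C i)) : t = d := by
  by_contra hne
  obtain ⟨I, hI, -⟩ := exists_regIdeal hT 0
  have hpos : 0 < Module.supportDim R (Quo I R) := by
    by_contra! hle
    have hadd := add_le_add_left hle (t : WithBot ℕ∞)
    rw [hI.supportDim_add, hd, zero_add] at hadd
    exact hne (le_antisymm htd (by exact_mod_cast hadd))
  obtain ⟨p, hp, hpm⟩ := exists_mem_associatedPrimes_ne_maximalIdeal hpos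
  have hprime : p.IsPrime := IsAssociatedPrime.isPrime hp
  obtain ⟨a, rfl⟩ := exists_comap_eq_of_mem_associatedPrimes hp
  obtain ⟨f, -, hf⟩ := exists_isSES_quo_mul I a
  have hle : I ≤ Submodule.comap (LinearMap.toSpanSingleton R R a) I :=
    fun r hr => I.mul_mem_right a hr
  have hfa : f ∘ₗ quoFactor hle R = a • LinearMap.id := by
    refine quo_hom_ext (LinearMap.ext_ring ?_)
    change f (quoMk _ R 1) = a • quoMk I R 1
    rw [hf, one_smul]
    exact congrArg (quoMk I R) (mul_one a).symm
  have hvanish := subsingleton_aExt_quo_of_isPrime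
    (hinj.subsingleton_ext hI ht (t + 1) (Nat.lt_succ_self t)) hprime hpm
  obtain ⟨κ, hκ⟩ := hI.exists_isFundamentalClass
  have hmem : ∀ c : C, a • c ∈ (I • ⊤ : Submodule R C) := fun c => by
    refine hκ.mem_smul_top C _ ?_
    have hsmul : LinearMap.toSpanSingleton R C (a • c) =
        a • LinearMap.toSpanSingleton R C c := by ext; simp
    rw [hsmul, extPost_smul,
      ← extPre_id t (extPost _ t (LinearMap.toSpanSingleton R C c) κ), ← extPre_smul, ← hfa,
      ← extPre_comp, Subsingleton.elim (extPre C t f _) 0, map_zero]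
  have ha : quoMk I R a = 0 := by
    refine (injective_iff_map_eq_zero _).1
      (RegIdeal.quoHom_bijective hann hC hext (regularUpTo_self t) hI le_rfl).1.1 _
      (LinearMap.ext fun c => quoMk_eq_zero_iff.2 (hmem c))
  refine hprime.ne_top (eq_top_iff.2 fun r _ => ?_)
  exact I.mul_mem_left r (mem_smul_top_self.1 (quoMk_eq_zero_iff.1 ha))

end CohenMacaulay

section Free

open IsLocalRing TensorProduct

variable (R : Type) [CommRing R]

/-- The homological hypotheses on `M` that pass to direct summands. -/
structure GoodModule (d : ℕ) (C M : Type) [AddCommGroup C] [Module R C] [AddCommGroup M]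
    [Module R M] : Prop where
  bijective : Function.Bijective (TensorProduct.mk R C M).flip
  ext_tensor : ∀ i, 1 ≤ i → Subsingleton (AExt R C (C ⊗[R] M) i)
  finInjDim : FinInjDim R (C ⊗[R] (M →ₗ[R] M))
  ext_ring : ∀ j, 1 ≤ j → j ≤ d → Subsingleton (AExt R M R j)
  ext_self : ∀ i, 1 ≤ i → i ≤ d - 1 → Subsingleton (AExt R M M i)

variable {R}

theorem FinInjDim.of_retract {X Y : Type} [AddCommGroup X] [Module R X] [AddCommGroup Y]
    [Module R Y] (hX : FinInjDim R X) (s : Y →ₗ[R] X) (p : X →ₗ[R] Y)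
    (h : p ∘ₗ s = LinearMap.id) : FinInjDim R Y := by
  obtain ⟨D, hD⟩ := hX
  exact ⟨D, fun i hi N _ _ _ => subsingleton_aExt_of_retract_right s p h (hD i hi N)⟩

theorem HasFiniteInjDim.of_retract {X Y : Type} [AddCommGroup X] [Module R X] [AddCommGroup Y]
    [Module R Y] (hX : HasFiniteInjDim R X) (s : Y →ₗ[R] X) (p : X →ₗ[R] Y)
    (h : p ∘ₗ s = LinearMap.id) : HasFiniteInjDim R Y := by
  obtain ⟨D, hD⟩ := hX
  exact ⟨D, fun N _ _ i hi => (subsingleton_extMod_iff i N Y).2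
    (subsingleton_aExt_of_retract_right s p h ((subsingleton_extMod_iff i N X).1 (hD N i hi)))⟩

theorem HasFiniteInjDim.finInjDim {X : Type} [AddCommGroup X] [Module R X]
    (hX : HasFiniteInjDim R X) : FinInjDim R X := by
  obtain ⟨D, hD⟩ := hX
  exact ⟨D, fun i hi N _ _ _ => (subsingleton_extMod_iff i N X).1 (hD N i hi)⟩

variable {C M L : Type} [AddCommGroup C] [Module R C] [AddCommGroup M] [Module R M]
  [AddCommGroup L] [Module R L] {d : ℕ}

theorem GoodModule.of_retract (hM : GoodModule R d C M) (s : L →ₗ[R] M) (p : M →ₗ[R] L)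
    (h : p ∘ₗ s = LinearMap.id) : GoodModule R d C L := by
  have hps : ∀ l, p (s l) = l := LinearMap.congr_fun h
  have hten : p.lTensor C ∘ₗ s.lTensor C = LinearMap.id := by
    rw [← LinearMap.lTensor_comp, h, LinearMap.lTensor_id]
  refine ⟨⟨(injective_iff_map_eq_zero _).2 fun l hl => ?_, fun w => ?_⟩, fun i hi =>
      subsingleton_aExt_of_retract_right _ _ hten (hM.ext_tensor i hi), ?_,
      fun j hj hjd => subsingleton_aExt_of_retract_left s p h (hM.ext_ring j hj hjd),
      fun i hi hid => subsingleton_aExt_of_retract_right s p h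
        (subsingleton_aExt_of_retract_left s p h (hM.ext_self i hi hid))⟩
  · have hsl : s l = 0 := (injective_iff_map_eq_zero _).1 hM.bijective.1 _
      (LinearMap.ext fun c => by
        have := congrArg (s.lTensor C) (LinearMap.congr_fun hl c)
        simpa using this)
    rw [← hps l, hsl, map_zero]
  · obtain ⟨m, hm⟩ := hM.bijective.2 (s.lTensor C ∘ₗ w)
    refine ⟨p m, LinearMap.ext fun c => ?_⟩
    have := congrArg (p.lTensor C) (LinearMap.congr_fun hm c)
    exact this.trans (LinearMap.congr_fun hten (w c))
  · refine hM.finInjDim.of_retract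
      ((LinearMap.lcomp R M p ∘ₗ LinearMap.llcomp R L L M s).lTensor C)
      ((LinearMap.lcomp R L s ∘ₗ LinearMap.llcomp R M M L p).lTensor C) ?_
    rw [← LinearMap.lTensor_comp, ← LinearMap.lTensor_id]
    congr 1
    ext g l
    simp [hps]

variable [IsNoetherianRing R] [IsLocalRing R] [Module.Finite R C] {t : ℕ}
  (ht : ¬ Subsingleton (AExt R (R ⧸ maximalIdeal R) R t))
  (hT : ∀ i < t, Subsingleton (AExt R (R ⧸ maximalIdeal R) R i)) (htd : t ≤ d)
  (hC : Module.annihilator R C = ⊥)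

include ht hT htd hC

theorem GoodModule.exists_apply_eq_one [Module.Finite R M] [Nontrivial M]
    (hM : GoodModule R d C M) : ∃ (π : M →ₗ[R] R) (e : M), π e = 1 := by
  obtain ⟨f, m, u, hu⟩ := exists_isUnit_apply ht hM.finInjDim htd hT hM.ext_ring hC hM.bijective
    hM.ext_tensor hM.ext_self
  exact ⟨f, (↑u⁻¹ : R) • m, by rw [map_smul, ← hu, smul_eq_mul, Units.inv_mul]⟩

theorem GoodModule.free_of_surjective [Module.Finite R M] (K : Submodule R M) :
    ∀ (L : Type) [AddCommGroup L] [Module R L] (q : M →ₗ[R] L), Function.Surjective q →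
      LinearMap.ker q = K → GoodModule R d C L → Module.Free R L := by
  induction K using IsNoetherian.induction with
  | hgt K ih =>
    intro L _ _ q hq hK hL
    have := Module.Finite.of_surjective q hq
    cases subsingleton_or_nontrivial L
    · infer_instance
    obtain ⟨π, e, he⟩ := hL.exists_apply_eq_one ht hT htd hC
    let ρ : L →ₗ[R] LinearMap.ker π :=
      (LinearMap.id - π.smulRight e).codRestrict _ fun l => by simp [he]
    have hρ_apply (l : L) : (ρ l : L) = l - π l • e := rfl
    have hρ : ρ ∘ₗ (LinearMap.ker π).subtype = LinearMap.id := by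
      ext l
      simp [hρ_apply, LinearMap.mem_ker.1 l.2]
    have hρs : Function.Surjective ρ := fun l => ⟨l, LinearMap.congr_fun hρ l⟩
    obtain ⟨x, hx⟩ := hq e
    have hlt : K < LinearMap.ker (ρ ∘ₗ q) := by
      refine lt_of_le_of_ne (hK ▸ LinearMap.ker_le_ker_comp q ρ) fun heq => ?_
      have hxK : x ∈ K := by
        rw [heq, LinearMap.mem_ker]
        ext
        simp [hρ_apply, hx, he]
      rw [← hK, LinearMap.mem_ker, hx] at hxK
      rw [hxK, map_zero] at he
      exact zero_ne_one he
    have hfree := ih _ hlt (LinearMap.ker π) (ρ ∘ₗ q) (hρs.comp hq) rfl (hL.of_retract _ ρ hρ)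
    refine Module.Free.of_equiv (M := R × LinearMap.ker π)
      (LinearEquiv.ofLinearMap ((LinearMap.toSpanSingleton R L e).coprod (LinearMap.ker π).subtype)
        (π.prod ρ) ?_ ?_)
    · ext l
      simp [hρ_apply]
    · ext <;> simp [hρ_apply, he]

theorem GoodModule.free [Module.Finite R M] (hM : GoodModule R d C M) : Module.Free R M :=
  GoodModule.free_of_surjective ht hT htd hC _ M LinearMap.id Function.surjective_id rfl hM

end Free

theorem IsSemidualizing.annihilator_eq_bot {R : Type} [CommRing R] {C : Type} [AddCommGroup C]
    [Module R C] (hC : IsSemidualizing R C) : Module.annihilator R C = ⊥ :=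
  (Submodule.eq_bot_iff _).2 fun r hr =>
    (injective_iff_map_eq_zero _).1 hC.bijective.1 r
      (LinearMap.ext fun c => Module.mem_annihilator.1 hr c)

open TensorProduct in
theorem HasFiniteInjDim.of_tensor_end {R : Type} [CommRing R] {C M : Type} [AddCommGroup C]
    [Module R C] [AddCommGroup M] [Module R M] (h : HasFiniteInjDim R (C ⊗[R] (M →ₗ[R] M)))
    {π : M →ₗ[R] R} {e : M} (he : π e = 1) : HasFiniteInjDim R C := by
  refine h.of_retract ((TensorProduct.mk R C (M →ₗ[R] M)).flip LinearMap.id)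
    ((TensorProduct.rid R C).toLinearMap ∘ₗ (π ∘ₗ LinearMap.applyₗ e).lTensor C) ?_
  ext c
  simp [he]

theorem cm_free_canonical_of_finite_C_injdim_endo
    (R : Type) [CommRing R] [IsNoetherianRing R] [IsLocalRing R]
    (d : ℕ) (hd : ringKrullDim R = d)
    (C : Type) [AddCommGroup C] [Module R C] [Module.Finite R C]
    (hC : IsSemidualizing R C)
    (M : Type) [AddCommGroup M] [Module R M] [Module.Finite R M] [Nontrivial M]
    (hM : MemAuslanderClass R C M)
    (hCinj : HasFiniteInjDim R (TensorProduct R C (M →ₗ[R] M)))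
    (hextM : ∀ i : ℕ, 1 ≤ i → i ≤ d - 1 → Subsingleton (extMod R i M M))
    (hextR : ∀ j : ℕ, 1 ≤ j → j ≤ d → Subsingleton (extMod R j M R)) :
    moduleDepth R R = d ∧ Module.Free R M ∧ HasFiniteInjDim R C := by
  obtain ⟨t, htd, hT, ht⟩ := exists_depth hd
  have hann := hC.annihilator_eq_bot
  have hgood : GoodModule R d C M :=
    ⟨hM.bijective, fun i hi => (subsingleton_extMod_iff i _ _).1 (hM.ext_vanish i hi),
      hCinj.finInjDim, fun j hj hjd => (subsingleton_extMod_iff j _ _).1 (hextR j hj hjd),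
      fun i hi hid => (subsingleton_extMod_iff i _ _).1 (hextM i hi hid)⟩
  obtain ⟨π, e, he⟩ := hgood.exists_apply_eq_one ht hT htd hann
  have hinj := hCinj.of_tensor_end he
  refine ⟨?_, hgood.free ht hT htd hann, hinj⟩
  obtain rfl := hinj.finInjDim.depth_eq_ringKrullDim hd htd hT ht hC.bijective hann
    fun i hi => (subsingleton_extMod_iff i _ _).1 (hC.ext_vanish i hi)
  have hmem : t ∈ {i : ℕ | ¬ Subsingleton (extMod R i (R ⧸ IsLocalRing.maximalIdeal R) R)} :=
    fun h => ht ((subsingleton_extMod_iff t _ _).1 h)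
  refine le_antisymm (Nat.sInf_le hmem) (le_csInf ⟨t, hmem⟩ fun i hi => ?_)
  by_contra! hlt
  exact hi ((subsingleton_extMod_iff i _ _).2 (hT i hlt))
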